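/- For each n ≥ 1 let 𝓜_n denote the set of pairs (F, M) where F is an acyclic simple graph (forest) on the vertex set Fin n and M is a maximal matching of F, let m_n = |𝓜_n|, let Ē_n = (Σ_{(F,M) ∈ 𝓜_n} |M|) / m_n, and let V̄_n = (Σ_{(F,M) ∈ 𝓜_n} |M|²) / m_n − Ē_n². Then the number of edges of a uniformly random element of 𝓜_n satisfies a central limit theorem: for every real number x, the proportion |{(F,M) ∈ 𝓜_n : |M| ≤ Ē_n + x·√V̄_n}| / m_n converges, as n → ∞, to Φ(x) = (1/√(2π)) ∫_{−∞}^{x} e^{−t²/2} dt, the standard Gaussian cumulative distribution function. -/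

import Mathlib

open Filter Topology MeasureTheory

/-- `M` is a matching of `G`: a set of edges of `G`, no two distinct
edges of which share a vertex. -/
def IsMatching {V : Type*} (G : SimpleGraph V) (M : Set (Sym2 V)) : Prop :=
  M ⊆ G.edgeSet ∧ ∀ e ∈ M, ∀ f ∈ M, e ≠ f → ∀ v : V, v ∈ e → v ∉ f

/-- `M` is a maximal matching of `G`. -/
def IsMaximalMatching {V : Type*} (G : SimpleGraph V) (M : Set (Sym2 V)) : Prop :=
  IsMatching G M ∧ ∀ M' : Set (Sym2 V), IsMatching G M' → ¬ M ⊂ M'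

/-- The pairs `(F, M)` where `F` is a forest (acyclic simple graph) on `Fin n`
and `M` is a maximal matching of `F`. -/
def MMSpace (n : ℕ) :=
  {p : SimpleGraph (Fin n) × Set (Sym2 (Fin n)) // p.1.IsAcyclic ∧ IsMaximalMatching p.1 p.2}

/-- `mN n` is the number of pairs `(F, M)` where `F` is a forest on `Fin n`
and `M` is a maximal matching of `F`. -/
noncomputable def mN (n : ℕ) : ℕ := Nat.card (MMSpace n)

/-- The expected number of edges of a uniformly random maximal matching–forest
pair on `n` vertices: the arithmetic mean of `|M|` over all pairs `(F, M)`. -/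
noncomputable def Ebar (n : ℕ) : ℝ :=
  (∑ᶠ p : MMSpace n, (p.val.2.ncard : ℝ)) / (mN n : ℝ)


/-- The variance of the number of edges of a uniformly random maximal
matching–forest pair on `n` vertices. -/
noncomputable def Vbar (n : ℕ) : ℝ :=
  (∑ᶠ p : MMSpace n, (p.val.2.ncard : ℝ) ^ 2) / (mN n : ℝ) - (Ebar n) ^ 2

/-- Every orbit of `h` leaves `A`. -/
def Escapes {V : Type*} (A : Finset V) (h : V → V) : Prop :=
  ∀ e, ∃ m, h^[m] e ∉ A

lemma escapes_insert_iff {V : Type*} [DecidableEq V] {A : Finset V} {a : V}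
    (h : V → V) :
    Escapes (insert a A) h ↔
      h a ≠ a ∧ Escapes A (fun x => if h x = a then h a else h x) := by
  set h' : V → V := fun x => if h x = a then h a else h x with hh'
  constructor
  · intro H
    have hne : h a ≠ a := by
      intro hfix
      obtain ⟨m, hm⟩ := H a
      rw [Function.iterate_fixed hfix] at hm
      simp at hm
    refine ⟨hne, ?_⟩
    have key : ∀ m e, h^[m] e ∉ insert a A → ∃ m', h'^[m'] e ∉ A := by
      intro m
      induction m using Nat.strong_induction_on with
      | _ m ih =>
        intro e he
        rcases m with _ | m
        · exact ⟨0, fun h0 => he (by simpa using Or.inr h0)⟩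
        · by_cases h1 : h e = a
          · have h2 : h' e = h a := by simp [hh', h1]
            rcases m with _ | m
            · simp [h1] at he
            · rw [Function.iterate_succ_apply, Function.iterate_succ_apply, h1] at he
              obtain ⟨m', hm'⟩ := ih m (by omega) _ he
              exact ⟨m' + 1, by rwa [Function.iterate_succ_apply, h2]⟩
          · have h2 : h' e = h e := by simp [hh', h1]
            rw [Function.iterate_succ_apply] at he
            obtain ⟨m', hm'⟩ := ih m (by omega) _ he
            exact ⟨m' + 1, by rwa [Function.iterate_succ_apply, h2]⟩
    intro e
    obtain ⟨m, hm⟩ := H e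
    exact key m e hm
  · rintro ⟨hne, H⟩
    have key : ∀ m e, e ≠ a → h'^[m] e ∉ A → ∃ m', h^[m'] e ∉ insert a A := by
      intro m
      induction m with
      | zero => exact fun e hea he => ⟨0, by simpa [hea] using he⟩
      | succ m ih =>
        intro e hea he
        rw [Function.iterate_succ_apply] at he
        by_cases h1 : h e = a
        · have h2 : h' e = h a := by simp [hh', h1]
          rw [h2] at he
          obtain ⟨m', hm'⟩ := ih _ hne he
          refine ⟨m' + 2, ?_⟩
          rwa [Function.iterate_succ_apply, Function.iterate_succ_apply, h1]
        · have h2 : h' e = h e := by simp [hh', h1]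
          rw [h2] at he
          obtain ⟨m', hm'⟩ := ih _ h1 he
          exact ⟨m' + 1, by rwa [Function.iterate_succ_apply]⟩
    intro e
    by_cases hea : e = a
    · obtain ⟨m, hm⟩ := H (h a)
      obtain ⟨m', hm'⟩ := key m _ hne hm
      exact ⟨m' + 1, by rwa [Function.iterate_succ_apply, hea]⟩
    · obtain ⟨m, hm⟩ := H e
      exact key m e hea hm

open Classical in
/-- A weighted Cayley formula: the number of ways to choose values on `A` so that the orbits of
`ρ ∘ q` leave `A`. -/
lemma card_escapes {V : Type*} [Fintype V] (A : Finset V) (ρ c : V → V) :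
    Finset.card {q : V → V | (∀ v ∉ A, q v = c v) ∧ Escapes A (ρ ∘ q)} * Fintype.card V =
      Finset.card {w | ρ w ∉ A} * Fintype.card V ^ A.card := by
  induction A using Finset.induction_on generalizing ρ c with
  | empty =>
    have : ({q : V → V | (∀ v ∉ (∅ : Finset V), q v = c v) ∧ Escapes ∅ (ρ ∘ q)} : Finset _) =
        {c} := by
      ext q
      simp [Escapes, funext_iff]
    rw [this]
    simp
  | insert a A ha ih =>
    have hfib : ∀ w : V, Finset.card {q ∈ ({q : V → V | (∀ v ∉ insert a A, q v = c v) ∧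
        Escapes (insert a A) (ρ ∘ q)} : Finset (V → V)) | q a = w} =
        if ρ w = a then 0 else Finset.card {q : V → V | (∀ v ∉ A, q v = Function.update c a w v) ∧
          Escapes A ((fun x => if ρ x = a then ρ w else ρ x) ∘ q)} := by
      intro w
      split_ifs with hw
      · rw [Finset.card_eq_zero, Finset.filter_eq_empty_iff]
        intro q hq hqa
        rw [Finset.mem_filter, escapes_insert_iff] at hq
        exact hq.2.2.1 (by simp [hqa, hw])
      · congr 1
        ext q
        simp only [Finset.mem_filter, Finset.mem_univ, true_and, escapes_insert_iff,
          Function.comp_apply]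
        constructor
        · rintro ⟨⟨h1, h2, h3⟩, rfl⟩
          refine ⟨fun v hv => ?_, h3⟩
          by_cases hva : v = a
          · simp [hva]
          · simp [hva, h1 v (by simp [hva, hv])]
        · rintro ⟨h1, h2⟩
          have hqa : q a = w := by simpa using h1 a ha
          refine ⟨⟨fun v hv => ?_, by rwa [hqa], ?_⟩, hqa⟩
          · have hva : v ≠ a := fun h => hv (by simp [h])
            have := h1 v (fun h => hv (by simp [h]))
            simpa [hva] using this
          · rw [hqa]; exact h2
    rw [Finset.card_eq_sum_card_fiberwise (f := fun q : V → V => q a) (t := Finset.univ)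
      (by simp [Set.MapsTo])]
    simp_rw [hfib]
    rw [Finset.sum_mul]
    have hterm : ∀ w : V, (if ρ w = a then 0 else
        Finset.card {q : V → V | (∀ v ∉ A, q v = Function.update c a w v) ∧
          Escapes A ((fun x => if ρ x = a then ρ w else ρ x) ∘ q)}) * Fintype.card V =
        (if ρ w ∉ insert a A then Finset.card {x | ρ x ∉ A} else
          if ρ w ∈ A then Finset.card {x | ρ x ∉ insert a A} else 0) * Fintype.card V ^ A.card := by
      intro w
      by_cases hw : ρ w = a
      · simp [hw, ha]
      · rw [if_neg hw, ih]
        by_cases hwA : ρ w ∈ A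
        · rw [if_neg (by simp [hwA]), if_pos hwA]
          congr 2
          ext x
          by_cases hx : ρ x = a <;> simp [hx, hwA]
        · rw [if_pos (by simp [hwA, hw])]
          congr 2
          ext x
          by_cases hx : ρ x = a <;> simp [hx, hwA, ha]
    rw [Finset.sum_congr rfl (fun w _ => hterm w), ← Finset.sum_mul]
    rw [Finset.card_insert_of_notMem ha, pow_succ', ← mul_assoc]
    congr 1
    have hsplit : ∀ w : V, (if ρ w ∉ insert a A then Finset.card {x | ρ x ∉ A} else
          if ρ w ∈ A then Finset.card {x | ρ x ∉ insert a A} else 0) =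
          (if ρ w ∉ insert a A then Finset.card {x | ρ x ∉ A} else 0) +
          (if ρ w ∈ A then Finset.card {x | ρ x ∉ insert a A} else 0) := by
      intro w
      by_cases h1 : ρ w ∈ A <;> simp [h1]
    rw [Finset.sum_congr rfl (fun w _ => hsplit w), Finset.sum_add_distrib]
    rw [← Finset.sum_filter, ← Finset.sum_filter, Finset.sum_const, Finset.sum_const]
    have hcompl : Finset.card {x | ρ x ∉ A} + Finset.card {x | ρ x ∈ A} = Fintype.card V := by
      rw [add_comm, Finset.card_filter_add_card_filter_not, Finset.card_univ]
    simp only [smul_eq_mul]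
    rw [← hcompl]
    ring

/-- `p` agrees with `c` except at the fixed points of `c` other than `r`, and all orbits
of `p` end at `r`. -/
def RootedAt {V : Type*} (c : V → V) (r : V) (p : V → V) : Prop :=
  (∀ v, (c v ≠ v ∨ v = r) → p v = c v) ∧ ∀ v, ∃ m, p^[m] v = r

open Classical in
lemma rootedAt_iff_escapes {V : Type*} [Fintype V] {c : V → V} (hc : ∀ v, c (c (c v)) = c (c v))
    {r : V} (hr : c r = r) (p : V → V) :
    RootedAt c r p ↔ (∀ v ∉ ({v | c v = v ∧ v ≠ r} : Finset V), p v = c v) ∧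
      Escapes {v | c v = v ∧ v ≠ r} ((fun v => c (c v)) ∘ p) := by
  unfold RootedAt
  have h0 : (∀ v, (c v ≠ v ∨ v = r) → p v = c v) ↔
      ∀ v ∉ ({v | c v = v ∧ v ≠ r} : Finset V), p v = c v := by
    refine forall_congr' fun v => ?_
    simp only [Finset.mem_filter, Finset.mem_univ, true_and]
    tauto
  rw [← h0]
  refine and_congr_right fun hp => ?_
  have hpr : p r = r := by rw [hp r (Or.inr rfl), hr]
  set h : V → V := (fun v => c (c v)) ∘ p with hh
  have hstep : ∀ v, ∃ i, p^[i] v = c (c v) := by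
    intro v
    by_cases h1 : c v = v
    · exact ⟨0, by simp [h1]⟩
    · by_cases h2 : c (c v) = c v
      · exact ⟨1, by simp [hp v (Or.inl h1), h2]⟩
      · exact ⟨2, by simp [hp v (Or.inl h1), hp _ (Or.inl h2)]⟩
  constructor
  · intro H e
    have key : ∀ m e, p^[m] e = r → ∃ m', h^[m'] e ∉ ({v | c v = v ∧ v ≠ r} : Finset V) := by
      intro m
      induction m using Nat.strong_induction_on with
      | _ m ih =>
        intro e he
        obtain ⟨i, hi⟩ := hstep (p e)
        have hi' : p^[i + 1] e = h e := by rw [Function.iterate_succ_apply, hi]; rfl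
        by_cases hm : i + 1 ≤ m
        · obtain ⟨m', hm'⟩ := ih (m - (i + 1)) (by omega) (h e) (by
            rw [← hi', ← Function.iterate_add_apply, Nat.sub_add_cancel hm, he])
          exact ⟨m' + 1, by rwa [Function.iterate_succ_apply]⟩
        · refine ⟨1, ?_⟩
          have : h e = r := by
            rw [← hi', show i + 1 = (i + 1 - m) + m by omega, Function.iterate_add_apply, he,
              Function.iterate_fixed hpr]
          simp [this]
    obtain ⟨m, hm⟩ := H e
    exact key m e hm
  · intro H v
    have key : ∀ m e, c e = e → h^[m] e ∉ ({v | c v = v ∧ v ≠ r} : Finset V) →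
        ∃ m', p^[m'] e = r := by
      intro m
      induction m with
      | zero =>
        intro e hce he
        exact ⟨0, by simpa [hce] using he⟩
      | succ m ih =>
        intro e hce he
        rw [Function.iterate_succ_apply] at he
        obtain ⟨m', hm'⟩ := ih (h e) (hc _) he
        obtain ⟨i, hi⟩ := hstep (p e)
        refine ⟨m' + (i + 1), ?_⟩
        rw [Function.iterate_add_apply, Function.iterate_succ_apply, hi]
        exact hm'
    obtain ⟨i, hi⟩ := hstep v
    obtain ⟨m, hm⟩ := H (c (c v))
    obtain ⟨m', hm'⟩ := key m _ (hc v) hm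
    exact ⟨m' + i, by rw [Function.iterate_add_apply, hi, hm']⟩

open Classical in
lemma card_rootedAt {V : Type*} [Fintype V] [Nonempty V] {c : V → V}
    (hc : ∀ v, c (c (c v)) = c (c v)) :
    Finset.card {x : V × (V → V) | c x.1 = x.1 ∧ RootedAt c x.1 x.2} * Fintype.card V =
      Fintype.card V ^ Finset.card {v | c v = v} := by
  rw [Finset.card_eq_sum_card_fiberwise (f := Prod.fst) (t := {r | c r = r})
    (by intro x hx; simp at hx ⊢; exact hx.1), Finset.sum_mul]
  have hfib : ∀ r ∈ ({r | c r = r} : Finset V), Finset.card {x ∈ ({x : V × (V → V) | c x.1 = x.1 ∧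
      RootedAt c x.1 x.2} : Finset _) | x.1 = r} * Fintype.card V =
      Finset.card {w | c (c w) = r} * Fintype.card V ^ (Finset.card {v | c v = v} - 1) := by
    intro r hr
    rw [Finset.mem_filter] at hr
    have h1 := card_escapes ({v | c v = v ∧ v ≠ r} : Finset V) (fun v => c (c v)) c
    have h2 : Finset.card {w | c (c w) ∉ ({v | c v = v ∧ v ≠ r} : Finset V)} =
        Finset.card {w | c (c w) = r} := by
      congr 1
      ext w
      simp [hc]
    have h3 : Finset.card {v | c v = v ∧ v ≠ r} = Finset.card {v | c v = v} - 1 := by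
      rw [← Finset.card_erase_of_mem (s := {v | c v = v}) (a := r) (by simp [hr.2])]
      congr 1
      ext v
      simp [and_comm]
    rw [h2, h3] at h1
    rw [← h1]
    congr 1
    refine Finset.card_bij (fun x _ => x.2) ?_ ?_ ?_
    · rintro ⟨r', p⟩ hx
      simp only [Finset.mem_filter, Finset.mem_univ, true_and] at hx
      obtain ⟨⟨h4, h5⟩, rfl⟩ := hx
      rw [Finset.mem_filter, ← rootedAt_iff_escapes hc h4]
      exact ⟨Finset.mem_univ _, h5⟩
    · rintro ⟨r', p⟩ hx ⟨r'', p'⟩ hx' hpp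
      simp only [Finset.mem_filter] at hx hx'
      ext1
      · exact hx.2.trans hx'.2.symm
      · exact hpp
    · intro p hp
      rw [Finset.mem_filter, ← rootedAt_iff_escapes hc hr.2] at hp
      exact ⟨(r, p), by simp [hr.2, hp.2], rfl⟩
  rw [Finset.sum_congr rfl hfib, ← Finset.sum_mul, ← Finset.card_eq_sum_card_fiberwise
    (f := fun w => c (c w)) (s := Finset.univ) (by intro x _; simp [hc]), Finset.card_univ]
  rcases Nat.eq_zero_or_pos (Finset.card {v | c v = v}) with h | h
  · obtain ⟨v⟩ := ‹Nonempty V›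
    have : c (c v) ∈ ({v | c v = v} : Finset V) := by simp [hc]
    rw [Finset.card_eq_zero] at h
    simp [h] at this
  · rw [← pow_succ', Nat.sub_add_cancel h]

/-- The graph whose edges join each vertex to its image under `p`. -/
def parentGraph {V : Type*} (p : V → V) : SimpleGraph V :=
  SimpleGraph.fromRel fun u v => p u = v

lemma parentGraph_adj {V : Type*} {p : V → V} {u v : V} :
    (parentGraph p).Adj u v ↔ u ≠ v ∧ (p u = v ∨ p v = u) := Iff.rfl

/-- `p` fixes `r` and all orbits of `p` end at `r`. -/
def IsParentMap {V : Type*} (r : V) (p : V → V) : Prop :=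
  p r = r ∧ ∀ v, ∃ m, p^[m] v = r

lemma IsParentMap.ne {V : Type*} {r : V} {p : V → V} (hp : IsParentMap r p) {v : V} (hv : v ≠ r) :
    p v ≠ v := by
  intro h
  obtain ⟨m, hm⟩ := hp.2 v
  rw [Function.iterate_fixed h] at hm
  exact hv hm

lemma IsParentMap.not_two_cycle {V : Type*} {r : V} {p : V → V} (hp : IsParentMap r p) {v : V}
    (hv : v ≠ r) : p (p v) ≠ v := by
  intro h
  have key : ∀ m, p^[m] v = v ∨ p^[m] v = p v := by
    intro m
    induction m with
    | zero => simp
    | succ m ih =>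
      rw [Function.iterate_succ_apply']
      rcases ih with h1 | h1 <;> rw [h1]
      · exact Or.inr rfl
      · exact Or.inl h
  obtain ⟨m, hm⟩ := hp.2 v
  rcases key m with h1 | h1
  · exact hv (h1.symm.trans hm)
  · have h2 : p v = r := h1.symm.trans hm
    rw [h2, hp.1] at h
    exact hv h.symm

lemma IsParentMap.reachable {V : Type*} {r : V} {p : V → V} (hp : IsParentMap r p) (v : V) :
    (parentGraph p).Reachable v r := by
  obtain ⟨m, hm⟩ := hp.2 v
  rw [← hm]
  clear hm
  induction m with
  | zero => simp
  | succ m ih =>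
    refine ih.trans ?_
    rw [Function.iterate_succ_apply']
    by_cases h : p^[m] v = p (p^[m] v)
    · rw [← h]
    · exact SimpleGraph.Adj.reachable (parentGraph_adj.2 ⟨h, Or.inl rfl⟩)

lemma IsParentMap.isTree {V : Type*} [Finite V] {r : V} {p : V → V} (hp : IsParentMap r p) :
    (parentGraph p).IsTree := by
  classical
  have := Fintype.ofFinite V
  have hconn : (parentGraph p).Connected :=
    { preconnected := fun u v => (hp.reachable u).trans (hp.reachable v).symm
      nonempty := ⟨r⟩ }
  rw [SimpleGraph.isTree_iff_connected_and_card]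
  refine ⟨hconn, le_antisymm ?_ hconn.card_vert_le_card_edgeSet_add_one⟩
  have hsub : (parentGraph p).edgeSet ⊆ ((Finset.univ.erase r).image fun v => s(v, p v) :
      Finset (Sym2 V)) := by
    intro e
    induction e with
    | _ u v =>
      intro he
      obtain ⟨hne, h | h⟩ := parentGraph_adj.1 he
      · have : u ≠ r := by
          rintro rfl
          rw [hp.1] at h
          exact hne h
        simp only [Finset.coe_image, Set.mem_image]
        exact ⟨u, by simpa using this, by rw [h]⟩
      · have : v ≠ r := by
          rintro rfl
          rw [hp.1] at h
          exact hne h.symm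
        simp only [Finset.coe_image, Set.mem_image]
        exact ⟨v, by simpa using this, by rw [h, Sym2.eq_swap]⟩
  have h1 := Set.ncard_le_ncard hsub
  rw [Set.ncard_coe_finset] at h1
  have h2 := h1.trans Finset.card_image_le
  rw [Finset.card_erase_of_mem (Finset.mem_univ _), Finset.card_univ] at h2
  rw [Nat.card_coe_set_eq, Nat.card_eq_fintype_card]
  have : 0 < Fintype.card V := Fintype.card_pos_iff.2 ⟨r⟩
  omega

lemma IsParentMap.injective {V : Type*} {r : V} {p p' : V → V} (hp : IsParentMap r p)
    (hp' : IsParentMap r p') (h : parentGraph p = parentGraph p') : p = p' := by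
  have key : ∀ m v, p^[m] v = r → p v = p' v := by
    intro m
    induction m with
    | zero =>
      intro v hv
      simp only [Function.iterate_zero, id_eq] at hv
      rw [hv, hp.1, hp'.1]
    | succ m ih =>
      intro v hv
      by_cases hvr : v = r
      · rw [hvr, hp.1, hp'.1]
      · rw [Function.iterate_succ_apply] at hv
        have h1 := ih _ hv
        have h2 : (parentGraph p').Adj v (p v) := by
          rw [← h]
          exact parentGraph_adj.2 ⟨(hp.ne hvr).symm, Or.inl rfl⟩
        rcases (parentGraph_adj.1 h2).2 with h3 | h3
        · exact h3.symm
        · rw [← h1] at h3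
          exact absurd h3 (hp.not_two_cycle hvr)
  funext v
  obtain ⟨m, hm⟩ := hp.2 v
  exact key m v hm

lemma exists_isParentMap {V : Type*} [Finite V] {T : SimpleGraph V} (hT : T.IsTree) (r : V) :
    ∃ p, IsParentMap r p ∧ parentGraph p = T := by
  have hex : ∀ v, v ≠ r → ∃ w, T.Adj v w ∧ T.dist w r + 1 = T.dist v r := by
    intro v hv
    obtain ⟨w, hw⟩ := (hT.connected v r).exists_walk_length_eq_dist
    cases w with
    | nil => exact absurd rfl hv
    | cons h q =>
      rename_i u
      refine ⟨u, h, ?_⟩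
      rw [SimpleGraph.Walk.length_cons] at hw
      have h1 := SimpleGraph.dist_le q
      have h2 := hT.connected.dist_triangle (u := v) (v := u) (w := r)
      rw [SimpleGraph.dist_eq_one_iff_adj.2 h] at h2
      omega
  classical
  choose f hf using hex
  set p : V → V := fun v => if h : v = r then r else f v h with hpdef
  have hpr : p r = r := by simp [hpdef]
  have hpv : ∀ v (h : v ≠ r), p v = f v h := fun v h => by simp [hpdef, h]
  have hp : IsParentMap r p := by
    refine ⟨hpr, ?_⟩
    have key : ∀ d v, T.dist v r = d → ∃ m, p^[m] v = r := by
      intro d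
      induction d with
      | zero =>
        intro v hv
        exact ⟨0, by simpa using (hT.connected.dist_eq_zero_iff).1 hv⟩
      | succ d ih =>
        intro v hv
        have hvr : v ≠ r := by
          rintro rfl
          simp at hv
        obtain ⟨m, hm⟩ := ih (p v) (by
          have := (hf v hvr).2
          rw [hpv v hvr]
          omega)
        exact ⟨m + 1, hm⟩
    exact fun v => key _ v rfl
  have hle : parentGraph p ≤ T := by
    have hadj : ∀ u v, u ≠ v → p u = v → T.Adj u v := by
      intro u v huv h
      have hur : u ≠ r := by
        rintro rfl
        exact huv (hpr.symm.trans h)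
      rw [← h, hpv u hur]
      exact (hf u hur).1
    intro u v huv
    obtain ⟨hne, h | h⟩ := parentGraph_adj.1 huv
    · exact hadj u v hne h
    · exact (hadj v u hne.symm h).symm
  exact ⟨p, hp, le_antisymm hle
    ((SimpleGraph.isTree_iff_minimal_connected.1 hT).2 hp.isTree.connected hle)⟩

/-- The 2-cycles of the involution `σ` are edges of `G`, and every edge of `G` has an end that is
moved by `σ`: this encodes a maximal matching of `G`. -/
def MatchedBy {V : Type*} (G : SimpleGraph V) (σ : Equiv.Perm V) : Prop :=
  (∀ v, σ (σ v) = v) ∧ (∀ v, σ v ≠ v → G.Adj v (σ v)) ∧ ∀ u v, G.Adj u v → σ u = u → σ v ≠ v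

/-- The condition on a parent map corresponding to `MatchedBy`. -/
def ParentMatched {V : Type*} (σ : Equiv.Perm V) (p : V → V) : Prop :=
  (∀ v, σ v ≠ v → p v = σ v ∨ p (σ v) = v) ∧ ∀ u, σ u = u → σ (p u) ≠ p u

/-- Maps collapsing each 2-cycle of `σ` to one of its points, and sending the fixed points of `σ` to
points moved by `σ`. -/
def IsCollapse {V : Type*} (σ : Equiv.Perm V) (c : V → V) : Prop :=
  (∀ v, c (σ v) = c v) ∧ (∀ v, σ v ≠ v → c v = v ∨ c v = σ v) ∧ ∀ u, σ u = u → σ (c u) ≠ c u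

section

variable {V : Type*} {σ : Equiv.Perm V}

lemma IsParentMap.matchedBy_iff {r : V} {p : V → V} (hp : IsParentMap r p)
    (hσ : ∀ v, σ (σ v) = v) (hr : σ r ≠ r) :
    MatchedBy (parentGraph p) σ ↔ ParentMatched σ p := by
  constructor
  · rintro ⟨-, h1, h2⟩
    refine ⟨fun v hv => (parentGraph_adj.1 (h1 v hv)).2, fun u hu => ?_⟩
    have hur : u ≠ r := by
      rintro rfl
      exact hr hu
    exact h2 u _ (parentGraph_adj.2 ⟨(hp.ne hur).symm, Or.inl rfl⟩) hu
  · rintro ⟨h1, h2⟩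
    refine ⟨hσ, fun v hv => parentGraph_adj.2 ⟨hv.symm, h1 v hv⟩, fun u v huv hu hv => ?_⟩
    obtain ⟨-, h | h⟩ := parentGraph_adj.1 huv
    · exact h2 u hu (by rw [h, hv])
    · exact h2 v hv (by rw [h, hu])

lemma IsCollapse.idem {c : V → V} (hc : IsCollapse σ c) (v : V) : c (c (c v)) = c (c v) := by
  have key : ∀ v, σ v ≠ v → c (c v) = c v := by
    intro v hv
    rcases hc.2.1 v hv with h | h
    · rw [h, h]
    · nth_rewrite 1 [h]
      exact hc.1 v
  by_cases hv : σ v = v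
  · exact key _ (hc.2.2 v hv)
  · rw [key v hv, key v hv]

open Classical in
/-- The collapse underlying a parent map. -/
noncomputable def collapseOf (σ : Equiv.Perm V) (p : V → V) : V → V :=
  fun v => if σ v ≠ v ∧ p v ≠ σ v then v else p v

lemma IsParentMap.not_both {r : V} {p : V → V} (hp : IsParentMap r p) {v : V}
    (hv : σ v ≠ v) (h1 : p v = σ v) (h2 : p (σ v) = v) : False := by
  by_cases hvr : v = r
  · have : p v = v := by rw [hvr]; exact hp.1
    exact hv (h1.symm.trans this)
  · exact hp.not_two_cycle hvr (by rw [h1, h2])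

lemma isCollapse_collapseOf {r : V} {p : V → V} (hp : IsParentMap r p) (hσ : ∀ v, σ (σ v) = v)
    (hm : ParentMatched σ p) : IsCollapse σ (collapseOf σ p) := by
  refine ⟨fun v => ?_, fun v hv => ?_, fun u hu => ?_⟩
  · by_cases hv : σ v = v
    · rw [hv]
    · have hv' : σ (σ v) ≠ σ v := by rw [hσ]; exact fun h => hv h.symm
      by_cases h : p v = σ v
      · have h2 : p (σ v) ≠ v := fun h2 => hp.not_both hv h h2
        simp [collapseOf, hv, hσ, h2, h, Ne.symm hv]
      · have h2 := (hm.1 v hv).resolve_left h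
        simp [collapseOf, hv, hσ, h2, h]
  · by_cases h : p v = σ v <;> simp [collapseOf, h, hv]
  · have := hm.2 u hu
    simpa [collapseOf, hu] using this

lemma IsCollapse.rootedAt_iff {c : V → V} (hc : IsCollapse σ c) (r : V) (p : V → V) :
    (c r = r ∧ RootedAt c r p) ↔
      (σ r ≠ r ∧ IsParentMap r p ∧ ParentMatched σ p) ∧ collapseOf σ p = c := by
  constructor
  · rintro ⟨hr, h1, h2⟩
    have hp : IsParentMap r p := ⟨(h1 r (Or.inr rfl)).trans hr, h2⟩
    refine ⟨⟨fun h => hc.2.2 r h (by rw [hr, h]), hp, fun v hv => ?_, fun u hu => ?_⟩, ?_⟩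
    · rcases hc.2.1 v hv with h | h
      · right
        have h3 : c (σ v) = v := (hc.1 v).trans h
        rw [h1 _ (Or.inl (by rw [h3]; exact hv.symm)), h3]
      · left
        rw [h1 _ (Or.inl (by rw [h]; exact hv)), h]
    · have h3 := hc.2.2 u hu
      rw [h1 u (Or.inl fun h => h3 (by rw [h, hu]))]
      exact h3
    · funext v
      by_cases hv : σ v = v
      · have h3 := hc.2.2 v hv
        simp only [collapseOf, hv, ne_eq, not_true_eq_false, false_and, if_false]
        exact h1 v (Or.inl fun h => h3 (by rw [h, hv]))
      · rcases hc.2.1 v hv with h | h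
        · have h3 : c (σ v) = v := (hc.1 v).trans h
          have h4 : p (σ v) = v := by rw [h1 _ (Or.inl (by rw [h3]; exact fun h => hv h.symm)), h3]
          have h5 : p v ≠ σ v := fun h5 => hp.not_both hv h5 h4
          simp [collapseOf, hv, h5, h]
        · have h3 : p v = σ v := by rw [h1 _ (Or.inl (by rw [h]; exact hv)), h]
          simp [collapseOf, h3, h]
  · rintro ⟨⟨hr, hp, hm⟩, rfl⟩
    have hcr : collapseOf σ p r = r := by
      simp [collapseOf, hp.1]
    refine ⟨hcr, fun v hv => ?_, hp.2⟩
    rcases hv with hv | rfl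
    · by_cases h : σ v ≠ v ∧ p v ≠ σ v
      · simp [collapseOf, h] at hv
      · simp only [collapseOf, if_neg h]
    · rw [hcr, hp.1]

open Classical in
lemma two_mul_card_transversal [Fintype V] (hσ : ∀ v, σ (σ v) = v) (P : V → Prop)
    (hP : ∀ v, σ v ≠ v → (P (σ v) ↔ ¬ P v)) (hP' : ∀ v, P v → σ v ≠ v) :
    2 * Finset.card {v | P v} = Finset.card {v | σ v ≠ v} := by
  rw [← Finset.card_filter_add_card_filter_not (s := {v | σ v ≠ v}) P, two_mul]
  congr 1
  · congr 1
    ext v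
    simp only [Finset.mem_filter, Finset.mem_univ, true_and]
    exact ⟨fun h => ⟨hP' v h, h⟩, fun h => h.2⟩
  · refine Finset.card_bij (fun v _ => σ v) ?_ (fun _ _ _ _ h => σ.injective h) ?_
    · intro v hv
      simp only [Finset.mem_filter, Finset.mem_univ, true_and] at hv ⊢
      have := hP' v hv
      refine ⟨by rw [hσ]; exact this.symm, fun h => (hP v this).1 h hv⟩
    · intro v hv
      simp only [Finset.mem_filter, Finset.mem_univ, true_and] at hv
      refine ⟨σ v, ?_, hσ v⟩
      simp only [Finset.mem_filter, Finset.mem_univ, true_and]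
      exact (hP v hv.1).2 hv.2

open Classical in
lemma IsCollapse.two_mul_card_fixed [Fintype V] {c : V → V} (hc : IsCollapse σ c)
    (hσ : ∀ v, σ (σ v) = v) :
    2 * Finset.card {v | c v = v} = Finset.card {v | σ v ≠ v} := by
  refine two_mul_card_transversal hσ _ (fun v hv => ?_) (fun v hv h => ?_)
  · rw [hc.1 v]
    rcases hc.2.1 v hv with h | h
    · simp [h, hv.symm]
    · simp [h, hv]
  · exact hc.2.2 v h (by rw [hv, h])

open Classical in
lemma card_isCollapse [Fintype V] [LinearOrder V] (hσ : ∀ v, σ (σ v) = v) :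
    Finset.card {c : V → V | IsCollapse σ c} =
      2 ^ (Finset.card {v | σ v ≠ v} / 2) *
        Finset.card {v | σ v ≠ v} ^ (Fintype.card V - Finset.card {v | σ v ≠ v}) := by
  set t : V → Finset V := fun v => if v < σ v then {v, σ v} else
    if σ v = v then ({w | σ w ≠ w} : Finset V) else {v} with ht
  have h1 : Finset.card {c : V → V | IsCollapse σ c} = (Fintype.piFinset t).card := by
    refine Finset.card_bij (fun c _ v => if v ≤ σ v then c v else v) ?_ ?_ ?_
    · intro c hc
      simp only [Finset.mem_filter, Finset.mem_univ, true_and] at hc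
      rw [Fintype.mem_piFinset]
      intro v
      rcases lt_trichotomy v (σ v) with h | h | h
      · simp only [ht, h, h.le, if_true, Finset.mem_insert, Finset.mem_singleton]
        exact hc.2.1 v h.ne'
      · have := hc.2.2 v h.symm
        simp only [ht, ← h, lt_irrefl, le_refl, if_true, if_false]
        simpa using this
      · simp [ht, h.not_ge, h.not_gt, h.ne]
    · intro c hc c' hc' hcc
      simp only [Finset.mem_filter, Finset.mem_univ, true_and] at hc hc'
      have h2 : ∀ v, v ≤ σ v → c v = c' v := by
        intro v hv
        have := congrFun hcc v
        simpa [hv] using this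
      funext v
      rcases le_total v (σ v) with h | h
      · exact h2 v h
      · rw [← hc.1 v, ← hc'.1 v]
        exact h2 _ (by rwa [hσ])
    · intro d hd
      rw [Fintype.mem_piFinset] at hd
      refine ⟨fun v => if v ≤ σ v then d v else d (σ v), ?_, ?_⟩
      · simp only [Finset.mem_filter, Finset.mem_univ, true_and]
        refine ⟨fun v => ?_, fun v hv => ?_, fun u hu => ?_⟩
        · rcases lt_trichotomy v (σ v) with h | h | h
          · simp [hσ, h.not_ge, h.le]
          · rw [← h]
          · simp [hσ, h.not_ge, h.le]
        · rcases lt_or_gt_of_ne hv with h | h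
          · have := hd (σ v)
            simp only [ht, hσ, h, if_true, Finset.mem_insert, Finset.mem_singleton] at this
            simp only [h.not_ge, if_false]
            tauto
          · have := hd v
            simp only [ht, h, if_true, Finset.mem_insert, Finset.mem_singleton] at this
            simpa only [h.le, if_true] using this
        · have := hd u
          simp only [ht, hu, lt_irrefl, if_false, if_true, Finset.mem_filter] at this
          simpa [hu] using this
      · funext v
        rcases lt_or_ge (σ v) v with h | h
        · have := hd v
          simp only [ht, h.not_gt, h.ne, if_false, Finset.mem_singleton] at this
          simp [h.not_ge, this]
        · simp [h]
  rw [h1, Fintype.card_piFinset]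
  have h2 : ∀ v, (t v).card = (if v < σ v then 2 else 1) *
      (if σ v = v then Finset.card {w | σ w ≠ w} else 1) := by
    intro v
    rcases lt_trichotomy v (σ v) with h | h | h
    · simp only [ht, h, h.ne', if_true, if_false]
      rw [Finset.card_pair h.ne]
    · simp only [ht, ← h, lt_irrefl, if_true, if_false, one_mul]
    · simp [ht, h.not_gt, h.ne]
  simp_rw [h2]
  rw [Finset.prod_mul_distrib, Finset.prod_ite, Finset.prod_ite]
  simp only [Finset.prod_const, one_pow, mul_one]
  have h3 : 2 * Finset.card {v | v < σ v} = Finset.card {v | σ v ≠ v} := by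
    convert two_mul_card_transversal hσ (fun v => v < σ v) (fun v hv => ?_) (fun v hv => hv.ne')
    rw [hσ, not_lt]
    exact ⟨le_of_lt, fun h => lt_of_le_of_ne h hv⟩
  have h4 := Finset.card_filter_add_card_filter_not (s := (Finset.univ : Finset V))
    (fun v => σ v = v)
  rw [Finset.card_univ] at h4
  congr 2
  · omega
  · change Finset.card {v | σ v = v} + Finset.card {v | σ v ≠ v} = _ at h4
    omega

open Classical in
/-- The number of trees on `V` having a given maximal matching. -/
lemma card_isTree_matchedBy [Fintype V] [Nonempty V] (hσ : ∀ v, σ (σ v) = v) :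
    Finset.card {T : SimpleGraph V | T.IsTree ∧ MatchedBy T σ} * Finset.card {v | σ v ≠ v} *
        Fintype.card V =
      2 ^ (Finset.card {v | σ v ≠ v} / 2) *
        Finset.card {v | σ v ≠ v} ^ (Fintype.card V - Finset.card {v | σ v ≠ v}) *
        Fintype.card V ^ (Finset.card {v | σ v ≠ v} / 2) := by
  have h1 : ∀ r, σ r ≠ r → Finset.card {T : SimpleGraph V | T.IsTree ∧ MatchedBy T σ} =
      Finset.card {p : V → V | IsParentMap r p ∧ ParentMatched σ p} := by
    intro r hr
    symm
    refine Finset.card_bij (fun p _ => parentGraph p) ?_ ?_ ?_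
    · intro p hp
      simp only [Finset.mem_filter, Finset.mem_univ, true_and] at hp ⊢
      exact ⟨hp.1.isTree, (hp.1.matchedBy_iff hσ hr).2 hp.2⟩
    · intro p hp p' hp' h
      simp only [Finset.mem_filter, Finset.mem_univ, true_and] at hp hp'
      exact hp.1.injective hp'.1 h
    · intro T hT
      simp only [Finset.mem_filter, Finset.mem_univ, true_and] at hT
      obtain ⟨p, hp, rfl⟩ := exists_isParentMap hT.1 r
      exact ⟨p, by simpa using ⟨hp, (hp.matchedBy_iff hσ hr).1 hT.2⟩, rfl⟩
  set X : Finset (V × (V → V)) :=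
    {x | σ x.1 ≠ x.1 ∧ IsParentMap x.1 x.2 ∧ ParentMatched σ x.2} with hX
  have h2 : Finset.card {T : SimpleGraph V | T.IsTree ∧ MatchedBy T σ} *
      Finset.card {v | σ v ≠ v} = X.card := by
    rw [Finset.card_eq_sum_card_fiberwise (f := Prod.fst) (t := {r | σ r ≠ r})
      (by intro x hx; simp [hX] at hx ⊢; exact hx.1), mul_comm, ← smul_eq_mul, ← Finset.sum_const]
    refine Finset.sum_congr rfl fun r hr => ?_
    rw [Finset.mem_filter] at hr
    rw [h1 r hr.2]
    refine Finset.card_bij (fun p _ => (r, p)) ?_ ?_ ?_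
    · intro p hp
      simpa [hX, hr.2] using hp
    · intro p _ p' _ h
      exact (Prod.mk.inj h).2
    · rintro ⟨r', p⟩ hx
      simp only [hX, Finset.mem_filter, Finset.mem_univ, true_and] at hx
      obtain ⟨⟨_, h3⟩, rfl⟩ := hx
      exact ⟨p, by simpa using h3, rfl⟩
  have h3 : X.card * Fintype.card V = ∑ c ∈ ({c | IsCollapse σ c} : Finset (V → V)),
      Fintype.card V ^ (Finset.card {v | σ v ≠ v} / 2) := by
    rw [Finset.card_eq_sum_card_fiberwise (f := fun x => collapseOf σ x.2)
      (t := {c | IsCollapse σ c}) (by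
        intro x hx
        simp only [hX, Finset.coe_filter, Finset.mem_univ, true_and, Set.mem_ofPred_eq] at hx ⊢
        exact isCollapse_collapseOf hx.2.1 hσ hx.2.2), Finset.sum_mul]
    refine Finset.sum_congr rfl fun c hc => ?_
    rw [Finset.mem_filter] at hc
    rw [← hc.2.two_mul_card_fixed hσ, Nat.mul_div_cancel_left _ two_pos, ← card_rootedAt hc.2.idem]
    congr 2
    ext x
    simp only [hX, Finset.mem_filter, Finset.mem_univ, true_and]
    exact (hc.2.rootedAt_iff x.1 x.2).symm
  rw [h2, h3, Finset.sum_const, smul_eq_mul]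
  congr 1
  let _ : LinearOrder V := LinearOrder.lift' (Fintype.equivFin V) (Fintype.equivFin V).injective
  convert card_isCollapse hσ

end

/-- The number of forests on `V` with a maximal matching having `k` edges. -/
noncomputable def forestCount (V : Type*) (k : ℕ) : ℕ :=
  Nat.card {x : SimpleGraph V × Equiv.Perm V //
    x.1.IsAcyclic ∧ MatchedBy x.1 x.2 ∧ Nat.card {v // x.2 v ≠ v} = 2 * k}

/-- The number of trees on `V` with a maximal matching having `k` edges. -/
noncomputable def treeCount (V : Type*) (k : ℕ) : ℕ :=
  Nat.card {x : SimpleGraph V × Equiv.Perm V //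
    x.1.IsTree ∧ MatchedBy x.1 x.2 ∧ Nat.card {v // x.2 v ≠ v} = 2 * k}

open Classical in
lemma involutive_iff_cycleType {V : Type*} [Fintype V] (σ : Equiv.Perm V) (k : ℕ) :
    ((∀ v, σ (σ v) = v) ∧ Finset.card {v | σ v ≠ v} = 2 * k) ↔
      σ.cycleType = Multiset.replicate k 2 := by
  have hsupp : Finset.card {v | σ v ≠ v} = σ.cycleType.sum := by
    rw [Equiv.Perm.sum_cycleType]
    congr 1
  rw [hsupp]
  constructor
  · rintro ⟨h1, h2⟩
    have h3 : ∀ m ∈ σ.cycleType, m = 2 := by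
      intro m hm
      have h4 : orderOf σ ∣ 2 := orderOf_dvd_of_pow_eq_one (by ext v; simp [pow_two, h1])
      exact le_antisymm (Nat.le_of_dvd two_pos ((Equiv.Perm.dvd_of_mem_cycleType hm).trans h4))
        (Equiv.Perm.two_le_of_mem_cycleType hm)
    have h4 := Multiset.eq_replicate_card.2 h3
    rw [h4, Multiset.sum_replicate, smul_eq_mul] at h2
    rw [h4]
    congr 1
    omega
  · intro h
    refine ⟨fun v => ?_, by rw [h]; simp [mul_comm]⟩
    have h1 : orderOf σ ∣ 2 := by
      rw [← Equiv.Perm.lcm_cycleType, h, Multiset.lcm_dvd]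
      intro b hb
      rw [Multiset.eq_of_mem_replicate hb]
    have h2 := orderOf_dvd_iff_pow_eq_one.1 h1
    have h3 := congrArg (fun τ : Equiv.Perm V => τ v) h2
    simpa [pow_two] using h3

open Classical in
lemma card_involutions {V : Type*} [Fintype V] {k : ℕ} (hk : k ≠ 0) (hkn : 2 * k ≤ Fintype.card V) :
    Finset.card {σ : Equiv.Perm V | (∀ v, σ (σ v) = v) ∧ Finset.card {v | σ v ≠ v} = 2 * k} *
      ((Fintype.card V - 2 * k).factorial * 2 ^ k * k.factorial) = (Fintype.card V).factorial := by
  have h := Equiv.Perm.card_of_cycleType_mul_eq V (Multiset.replicate k 2)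
  rw [if_pos ⟨by simpa [mul_comm] using hkn, fun a ha => (Multiset.eq_of_mem_replicate ha).ge⟩] at h
  rw [Multiset.sum_replicate, smul_eq_mul, mul_comm k, Multiset.prod_replicate,
    Multiset.toFinset_replicate, if_neg hk, Finset.prod_singleton, Multiset.count_replicate_self]
    at h
  rw [← h]
  congr 2
  ext σ
  simp only [Finset.mem_filter, Finset.mem_univ, true_and]
  exact involutive_iff_cycleType σ k

lemma treeCount_mul {V : Type*} [Fintype V] {k : ℕ} (hk : k ≠ 0) (hkn : 2 * k ≤ Fintype.card V) :
    treeCount V k * (2 * k * Fintype.card V * k.factorial * (Fintype.card V - 2 * k).factorial) =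
      (Fintype.card V).factorial * (2 * k) ^ (Fintype.card V - 2 * k) * Fintype.card V ^ k := by
  classical
  have hpos : 0 < Fintype.card V := by omega
  have : Nonempty V := Fintype.card_pos_iff.1 hpos
  set Y : Finset (Equiv.Perm V) :=
    {σ | (∀ v, σ (σ v) = v) ∧ Finset.card {v | σ v ≠ v} = 2 * k} with hY
  have h1 : treeCount V k * (2 * k * Fintype.card V) =
      Y.card * (2 ^ k * (2 * k) ^ (Fintype.card V - 2 * k) * Fintype.card V ^ k) := by
    rw [treeCount, Nat.card_eq_fintype_card, Fintype.card_subtype,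
      Finset.card_eq_sum_card_fiberwise (f := Prod.snd) (t := Y), Finset.sum_mul,
      Finset.sum_const_nat]
    · intro σ hσ
      simp only [hY, Finset.mem_filter, Finset.mem_univ, true_and] at hσ
      have h2 := card_isTree_matchedBy hσ.1
      rw [hσ.2, Nat.mul_div_cancel_left _ two_pos, mul_assoc] at h2
      rw [← h2]
      congr 1
      symm
      refine Finset.card_bij (fun T _ => (T, σ)) ?_ ?_ ?_
      · intro T hT
        simp only [Finset.mem_filter, Finset.mem_univ, true_and] at hT
        simp only [Finset.mem_filter, Finset.mem_univ, true_and, and_true]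
        exact ⟨hT.1, hT.2, by rw [Nat.card_eq_fintype_card, Fintype.card_subtype, hσ.2]⟩
      · intro T _ T' _ h
        exact (Prod.mk.inj h).1
      · rintro ⟨T, τ⟩ hx
        simp only [Finset.mem_filter, Finset.mem_univ, true_and] at hx
        obtain ⟨⟨h3, h4, -⟩, rfl⟩ := hx
        exact ⟨T, by simpa using ⟨h3, h4⟩, rfl⟩
    · intro x hx
      simp only [Finset.coe_filter, Finset.mem_univ, true_and, Set.mem_ofPred_eq] at hx
      obtain ⟨-, h3, h4⟩ := hx
      rw [Nat.card_eq_fintype_card, Fintype.card_subtype] at h4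
      simpa [hY] using ⟨h3.1, h4⟩
  have h2 := card_involutions (V := V) hk hkn
  rw [← h2, mul_assoc (2 * k * Fintype.card V), ← mul_assoc, h1]
  ring

lemma treeCount_eq_zero {V : Type*} [Fintype V] {k : ℕ} (hkn : Fintype.card V < 2 * k) :
    treeCount V k = 0 := by
  classical
  rw [treeCount, Nat.card_eq_zero]
  left
  rw [isEmpty_subtype]
  rintro x ⟨-, -, h⟩
  have h1 := Fintype.card_subtype_le fun v => x.2 v ≠ v
  rw [← Nat.card_eq_fintype_card, h] at h1
  omega

lemma treeCount_zero {V : Type*} [Fintype V] :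
    treeCount V 0 = if Fintype.card V = 1 then 1 else 0 := by
  classical
  have hfix : ∀ x : SimpleGraph V × Equiv.Perm V, Nat.card {v // x.2 v ≠ v} = 2 * 0 →
      ∀ v, x.2 v = v := by
    intro x h v
    rw [mul_zero, Nat.card_eq_zero] at h
    by_contra hv
    rcases h with h | h
    · exact h.false ⟨v, hv⟩
    · exact h.not_finite inferInstance
  split_ifs with h
  · obtain ⟨v, hv⟩ := Fintype.card_eq_one_iff.1 h
    have : Subsingleton V := ⟨fun a b => (hv a).trans (hv b).symm⟩
    have : Nonempty V := ⟨v⟩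
    rw [treeCount, Nat.card_eq_one_iff_unique]
    refine ⟨⟨fun x y => Subtype.ext (Prod.ext (Subsingleton.elim _ _) (Subsingleton.elim _ _))⟩,
      ⟨⟨(⊥, 1), SimpleGraph.IsTree.of_subsingleton, ⟨by simp, by simp, by simp⟩, by simp⟩⟩⟩
  · rw [treeCount, Nat.card_eq_zero]
    left
    rw [isEmpty_subtype]
    rintro ⟨T, σ⟩ ⟨hT, hm, h0⟩
    have hσ := hfix _ h0
    have hne := hT.connected.nonempty
    have h1 : 1 < Fintype.card V := by
      have := Fintype.card_pos_iff.2 hne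
      omega
    have : Nontrivial V := Fintype.one_lt_card_iff_nontrivial.1 h1
    obtain ⟨v⟩ := hne
    obtain ⟨w, hw⟩ := hT.connected.preconnected.exists_adj_of_nontrivial v
    exact hm.2.2 v w hw (hσ v) (hσ w)

section
variable {α β : Type*} {G : SimpleGraph α} {H : SimpleGraph β}

lemma reachable_sum_inl_iff {a b : α} :
    (G ⊕g H).Reachable (.inl a) (.inl b) ↔ G.Reachable a b := by
  refine ⟨fun h => ?_, fun h => h.map SimpleGraph.Embedding.sumInl.toHom⟩
  rw [SimpleGraph.reachable_iff_reflTransGen] at h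
  have key : ∀ v, Relation.ReflTransGen (G ⊕g H).Adj (.inl a) v → ∀ b, v = .inl b →
      G.Reachable a b := by
    intro v hv
    induction hv with
    | refl =>
      intro b hb
      rw [Sum.inl.inj hb]
    | @tail y z _ hyz ih =>
      rintro b rfl
      rcases y with c | c
      · exact (ih c rfl).trans (SimpleGraph.Adj.reachable (by simpa using hyz))
      · simp at hyz
  exact key _ h b rfl

lemma isAcyclic_sum_iff : (G ⊕g H).IsAcyclic ↔ G.IsAcyclic ∧ H.IsAcyclic := by
  refine ⟨fun h => ⟨h.embedding SimpleGraph.Embedding.sumInl,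
    h.embedding SimpleGraph.Embedding.sumInr⟩, fun ⟨hG, hH⟩ => ?_⟩
  classical
  have key : ∀ (s : Set (α ⊕ β)), ((G ⊕g H).induce s).IsAcyclic → ∀ v ∈ s,
      (∀ w, (G ⊕g H).Reachable v w → w ∈ s) → ∀ c : (G ⊕g H).Walk v v, ¬ c.IsCycle := by
    intro s hs v hv hr c hc
    have hsupp : ∀ x ∈ c.support, x ∈ s := fun x hx => hr x ⟨c.takeUntil x hx⟩
    refine hs (c.induce s hsupp) ?_
    rw [← SimpleGraph.Walk.isCycle_map_iff_of_injective
      (f := (SimpleGraph.Embedding.induce s).toHom)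
      (SimpleGraph.Embedding.induce (G := G ⊕g H) s).injective, SimpleGraph.Walk.map_induce]
    exact hc
  rintro (a | b) c
  · refine key (Set.range Sum.inl) ?_ _ ⟨a, rfl⟩ ?_ c
    · have h1 : ∀ x : Set.range (Sum.inl : α → α ⊕ β), ∃ y, Sum.inl y = x.1 := fun x => x.2
      choose f hf using h1
      refine hG.comap ⟨f, ?_⟩ ?_
      · intro x y hxy
        rw [SimpleGraph.comap_adj] at hxy
        simpa [← hf] using hxy
      · intro x y hxy
        exact Subtype.ext (by rw [← hf, ← hf]; exact congrArg _ hxy)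
    · rintro (w | w) hw
      · exact ⟨w, rfl⟩
      · exact (SimpleGraph.not_reachable_sum_inl_inr _ _ hw).elim
  · refine key (Set.range Sum.inr) ?_ _ ⟨b, rfl⟩ ?_ c
    · have h1 : ∀ x : Set.range (Sum.inr : β → α ⊕ β), ∃ y, Sum.inr y = x.1 := fun x => x.2
      choose f hf using h1
      refine hH.comap ⟨f, ?_⟩ ?_
      · intro x y hxy
        rw [SimpleGraph.comap_adj] at hxy
        simpa [← hf] using hxy
      · intro x y hxy
        exact Subtype.ext (by rw [← hf, ← hf]; exact congrArg _ hxy)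
    · rintro (w | w) hw
      · exact (SimpleGraph.not_reachable_sum_inl_inr _ _ hw.symm).elim
      · exact ⟨w, rfl⟩

lemma matchedBy_sum_iff {σ : Equiv.Perm α} {τ : Equiv.Perm β} :
    MatchedBy (G ⊕g H) (Equiv.Perm.sumCongr σ τ) ↔ MatchedBy G σ ∧ MatchedBy H τ := by
  simp only [MatchedBy, Sum.forall, Equiv.Perm.sumCongr_apply, Sum.map_inl, Sum.map_inr, ne_eq,
    Sum.inl.injEq, Sum.inr.injEq, SimpleGraph.sum_adj_inl, SimpleGraph.sum_adj_inr]
  simp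
  tauto

lemma card_moved_sum [Finite α] [Finite β] (σ : Equiv.Perm α) (τ : Equiv.Perm β) :
    Nat.card {v // Equiv.Perm.sumCongr σ τ v ≠ v} =
      Nat.card {v // σ v ≠ v} + Nat.card {v // τ v ≠ v} := by
  rw [← Nat.card_sum, Nat.card_congr Equiv.subtypeSum]
  simp

lemma exists_eq_sum {F : SimpleGraph (α ⊕ β)} (h : ∀ a b, ¬ F.Adj (.inl a) (.inr b)) :
    F = F.comap Sum.inl ⊕g F.comap Sum.inr := by
  ext (a | a) (b | b)
  · simp
  · simp [h]
  · simpa [F.adj_comm] using h b a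
  · simp

lemma even_card_moved [Finite α] {σ : Equiv.Perm α} (h : ∀ v, σ (σ v) = v) :
    2 ∣ Nat.card {v // σ v ≠ v} := by
  classical
  have := Fintype.ofFinite α
  have h1 := Equiv.Perm.two_dvd_card_support (σ := σ) (by ext v; simp [pow_two, h])
  rw [Nat.card_eq_fintype_card, Fintype.card_subtype]
  exact h1

lemma card_component_left [Finite α] [Finite β] (a₀ : α) (k : ℕ) :
    Nat.card {x : SimpleGraph (α ⊕ β) × Equiv.Perm (α ⊕ β) //
      (x.1.IsAcyclic ∧ MatchedBy x.1 x.2 ∧ Nat.card {v // x.2 v ≠ v} = 2 * k) ∧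
        ∀ v, x.1.Reachable (.inl a₀) v ↔ v.isLeft} =
      ∑ i ∈ Finset.range (k + 1), treeCount α i * forestCount β (k - i) := by
  classical
  have := Fintype.ofFinite α
  have := Fintype.ofFinite β
  set D : Finset ((SimpleGraph α × Equiv.Perm α) × (SimpleGraph β × Equiv.Perm β)) :=
    {z | (z.1.1.IsTree ∧ MatchedBy z.1.1 z.1.2) ∧ (z.2.1.IsAcyclic ∧ MatchedBy z.2.1 z.2.2) ∧
      Nat.card {v // z.1.2 v ≠ v} + Nat.card {v // z.2.2 v ≠ v} = 2 * k} with hD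
  have hcard : D.card = ∑ i ∈ Finset.range (k + 1), treeCount α i * forestCount β (k - i) := by
    rw [Finset.card_eq_sum_card_fiberwise (f := fun z => Nat.card {v // z.1.2 v ≠ v} / 2)
      (t := Finset.range (k + 1))]
    · refine Finset.sum_congr rfl fun i hi => ?_
      rw [treeCount, forestCount, Nat.card_eq_fintype_card, Nat.card_eq_fintype_card,
        Fintype.card_subtype, Fintype.card_subtype, ← Finset.card_product]
      congr 1
      ext ⟨⟨G, σ⟩, ⟨H, τ⟩⟩
      simp only [hD, Finset.mem_filter, Finset.mem_univ, true_and, Finset.mem_product]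
      rw [Finset.mem_range] at hi
      constructor
      · rintro ⟨⟨h1, h2, h3⟩, h4⟩
        have h5 := even_card_moved h1.2.1
        exact ⟨⟨h1.1, h1.2, by omega⟩, h2.1, h2.2, by omega⟩
      · rintro ⟨⟨h1, h2, h3⟩, h4, h5, h6⟩
        exact ⟨⟨⟨h1, h2⟩, ⟨h4, h5⟩, by omega⟩, by omega⟩
    · rintro z hz
      simp only [hD, Finset.coe_filter, Finset.mem_univ, true_and, Set.mem_ofPred_eq] at hz
      simp only [Finset.coe_range, Set.mem_Iio]
      omega
  rw [← hcard, Nat.card_eq_fintype_card, Fintype.card_subtype]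
  symm
  refine Finset.card_bij (fun z _ => (z.1.1 ⊕g z.2.1, Equiv.Perm.sumCongr z.1.2 z.2.2)) ?_ ?_ ?_
  · rintro ⟨⟨G, σ⟩, ⟨H, τ⟩⟩ hz
    simp only [hD, Finset.mem_filter, Finset.mem_univ, true_and] at hz ⊢
    obtain ⟨⟨h1, h2⟩, ⟨h3, h4⟩, h5⟩ := hz
    refine ⟨⟨isAcyclic_sum_iff.2 ⟨h1.isAcyclic, h3⟩, matchedBy_sum_iff.2 ⟨h2, h4⟩, ?_⟩, ?_⟩
    · rw [card_moved_sum, h5]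
    · rintro (v | v)
      · simpa [reachable_sum_inl_iff] using h1.connected.preconnected a₀ v
      · simpa using SimpleGraph.not_reachable_sum_inl_inr _ _
  · rintro ⟨⟨G, σ⟩, ⟨H, τ⟩⟩ _ ⟨⟨G', σ'⟩, ⟨H', τ'⟩⟩ _ h
    simp only [Prod.mk.injEq] at h
    obtain ⟨h1, h2⟩ := h
    have h3 : G = G' := by
      ext a b
      rw [← SimpleGraph.sum_adj_inl (H := H), h1, SimpleGraph.sum_adj_inl]
    have h4 : H = H' := by
      ext a b
      rw [← SimpleGraph.sum_adj_inr (G := G), h1, SimpleGraph.sum_adj_inr]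
    have h5 := Equiv.Perm.sumCongrHom_injective (a₁ := (σ, τ)) (a₂ := (σ', τ')) h2
    simp_all
  · rintro ⟨F, σ⟩ hx
    simp only [Finset.mem_filter, Finset.mem_univ, true_and] at hx
    obtain ⟨⟨h1, h2, h3⟩, h4⟩ := hx
    have h5 : ∀ a b, ¬ F.Adj (.inl a) (.inr b) := by
      intro a b hab
      have h6 := ((h4 (.inl a)).2 rfl).trans hab.reachable
      simpa using (h4 _).1 h6
    obtain ⟨⟨σ₁, σ₂⟩, rfl⟩ : σ ∈ (Equiv.Perm.sumCongrHom α β).range := by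
      refine Equiv.Perm.mem_sumCongrHom_range_of_perm_mapsTo_inl ?_
      rintro _ ⟨a, rfl⟩
      by_cases h6 : σ (.inl a) = .inl a
      · exact ⟨a, h6.symm⟩
      · have h7 := h2.2.1 _ h6
        rcases h8 : σ (.inl a) with b | b
        · exact ⟨b, rfl⟩
        · exact (h5 a b (h8 ▸ h7)).elim
    change MatchedBy F (Equiv.Perm.sumCongr σ₁ σ₂) at h2
    change Nat.card {v // Equiv.Perm.sumCongr σ₁ σ₂ v ≠ v} = 2 * k at h3
    rw [card_moved_sum] at h3
    have h6 := exists_eq_sum h5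
    set G₁ := F.comap Sum.inl
    set G₂ := F.comap Sum.inr
    rw [h6] at h1 h2 h4
    rw [isAcyclic_sum_iff] at h1
    rw [matchedBy_sum_iff] at h2
    refine ⟨((G₁, σ₁), (G₂, σ₂)), ?_, ?_⟩
    · simp only [hD, Finset.mem_filter, Finset.mem_univ, true_and]
      have h7 := fun a => reachable_sum_inl_iff.1 ((h4 (.inl a)).2 rfl)
      have : Nonempty α := ⟨a₀⟩
      have h8 : G₁.Preconnected := fun a b => (h7 a).symm.trans (h7 b)
      exact ⟨⟨⟨⟨h8⟩, h1.1⟩, h2.1⟩, ⟨h1.2, h2.2⟩, h3⟩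
    · rw [h6]
      rfl

end

section
variable {V W : Type*}

lemma matchedBy_map_iff (e : V ≃ W) {G : SimpleGraph W} {σ : Equiv.Perm V} :
    MatchedBy (G.comap e) σ ↔ MatchedBy G (e.permCongr σ) := by
  simp only [MatchedBy, SimpleGraph.comap_adj, Equiv.permCongr_apply, ne_eq]
  refine and_congr ?_ (and_congr ?_ ?_)
  · rw [← e.forall_congr_right]
    simp
  · rw [← e.forall_congr_right (q := fun v => ¬ e (σ (e.symm v)) = v → _)]
    simp
  · rw [← e.forall_congr_right]
    refine forall_congr' fun u => ?_
    rw [← e.forall_congr_right]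
    simp

/-- Pull a graph with a permutation of its vertices back along a bijection. -/
def pairCongr (e : V ≃ W) :
    SimpleGraph W × Equiv.Perm W ≃ SimpleGraph V × Equiv.Perm V :=
  Equiv.prodCongr e.symm.simpleGraph e.symm.permCongr

lemma pairCongr_iff (e : V ≃ W) (x : SimpleGraph W × Equiv.Perm W) :
    (((pairCongr e x).1.IsAcyclic ↔ x.1.IsAcyclic) ∧ ((pairCongr e x).1.IsTree ↔ x.1.IsTree)) ∧
    (MatchedBy (pairCongr e x).1 (pairCongr e x).2 ↔ MatchedBy x.1 x.2) ∧
    Nat.card {v // (pairCongr e x).2 v ≠ v} = Nat.card {v // x.2 v ≠ v} ∧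
    ∀ u v, (pairCongr e x).1.Reachable u v ↔ x.1.Reachable (e u) (e v) := by
  have h1 : (pairCongr e x).1 = x.1.comap e := rfl
  have i := SimpleGraph.Iso.comap e x.1
  refine ⟨⟨?_, ?_⟩, ?_, ?_, ?_⟩
  · exact i.isAcyclic_iff
  · exact i.isTree_iff
  · rw [h1, matchedBy_map_iff e]
    have : e.permCongr (pairCongr e x).2 = x.2 := by ext; simp [pairCongr]
    rw [this]
  · refine Nat.card_congr (e.subtypeEquiv fun v => ?_)
    simp [pairCongr, Equiv.symm_apply_eq]
  · intro u v
    exact ((SimpleGraph.Iso.comap e x.1).reachable_iff).symm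

lemma forestCount_congr (e : V ≃ W) (k : ℕ) : forestCount V k = forestCount W k := by
  refine (Nat.card_congr ((pairCongr e).subtypeEquiv fun x => ?_)).symm
  obtain ⟨⟨h1, h2⟩, h3, h4, h5⟩ := pairCongr_iff e x
  rw [h1, h3, h4]

lemma treeCount_congr (e : V ≃ W) (k : ℕ) : treeCount V k = treeCount W k := by
  refine (Nat.card_congr ((pairCongr e).subtypeEquiv fun x => ?_)).symm
  obtain ⟨⟨h1, h2⟩, h3, h4, h5⟩ := pairCongr_iff e x
  rw [h2, h3, h4]

open Classical in
lemma card_component_eq [Fintype V] (S : Finset V) {v₀ : V} (hv : v₀ ∈ S) (k : ℕ) :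
    Nat.card {x : SimpleGraph V × Equiv.Perm V //
      (x.1.IsAcyclic ∧ MatchedBy x.1 x.2 ∧ Nat.card {v // x.2 v ≠ v} = 2 * k) ∧
        ∀ v, x.1.Reachable v₀ v ↔ v ∈ S} =
      ∑ i ∈ Finset.range (k + 1), treeCount (Fin S.card) i *
        forestCount (Fin (Fintype.card V - S.card)) (k - i) := by
  have e1 : S ≃ Fin S.card := S.equivFin
  have e2 : {v // ¬ v ∈ S} ≃ Fin (Fintype.card V - S.card) :=
    Fintype.equivFinOfCardEq (by
      rw [Fintype.card_subtype_compl, Fintype.card_coe])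
  simp_rw [← treeCount_congr e1, ← forestCount_congr e2]
  rw [← card_component_left (⟨v₀, hv⟩ : S)]
  have e : S ⊕ {v // ¬ v ∈ S} ≃ V := Equiv.sumCompl (fun v => v ∈ S)
  refine Nat.card_congr ((pairCongr (Equiv.sumCompl (fun v => v ∈ S))).subtypeEquiv fun x => ?_)
  obtain ⟨⟨h1, h2⟩, h3, h4, h5⟩ := pairCongr_iff (Equiv.sumCompl (fun v => v ∈ S)) x
  rw [h1, h3, h4]
  refine and_congr_right fun _ => ?_
  simp_rw [h5]
  rw [← (Equiv.sumCompl (fun v => v ∈ S)).forall_congr_right]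
  refine forall_congr' ?_
  rintro (v | v)
  · simp
  · simp [v.2]

lemma forestCount_eq_sum [Fintype V] [DecidableEq V] (v₀ : V) (k : ℕ) :
    forestCount V k = ∑ S : Finset V with v₀ ∈ S, ∑ i ∈ Finset.range (k + 1),
      treeCount (Fin S.card) i * forestCount (Fin (Fintype.card V - S.card)) (k - i) := by
  classical
  rw [forestCount, Nat.card_eq_fintype_card, Fintype.card_subtype,
    Finset.card_eq_sum_card_fiberwise
      (f := fun x : SimpleGraph V × Equiv.Perm V => ({v | x.1.Reachable v₀ v} : Finset V))
      (t := {S : Finset V | v₀ ∈ S})]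
  · refine Finset.sum_congr rfl fun S hS => ?_
    rw [← card_component_eq S (by simpa using hS), Nat.card_eq_fintype_card,
      Fintype.card_subtype, Finset.filter_filter]
    congr 1
    ext x
    simp [Finset.ext_iff]
  · intro x _
    simp

/-- Decomposing a forest according to the tree containing a marked vertex. -/
lemma mul_forestCount (n k : ℕ) :
    n * forestCount (Fin n) k = ∑ s ∈ Finset.range (n + 1), n.choose s * (s *
      ∑ i ∈ Finset.range (k + 1), treeCount (Fin s) i * forestCount (Fin (n - s)) (k - i)) := by
  have h1 : n * forestCount (Fin n) k = ∑ _v : Fin n, forestCount (Fin n) k := by simp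
  have h2 := Finset.sum_powerset_apply_card (f := fun s => s *
      ∑ i ∈ Finset.range (k + 1), treeCount (Fin s) i * forestCount (Fin (n - s)) (k - i))
      (x := (Finset.univ : Finset (Fin n)))
  simp only [Finset.card_univ, Fintype.card_fin, smul_eq_mul, Finset.powerset_univ] at h2
  rw [h1, ← h2, Finset.sum_congr rfl fun v _ => forestCount_eq_sum v k]
  simp only [Fintype.card_fin, Finset.sum_filter]
  rw [Finset.sum_comm]
  refine Finset.sum_congr rfl fun S _ => ?_
  rw [Finset.sum_ite_mem, Finset.univ_inter, Finset.sum_const, smul_eq_mul]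

end

lemma forestCount_zero {V : Type*} [IsEmpty V] (k : ℕ) :
    forestCount V k = if k = 0 then 1 else 0 := by
  split_ifs with h
  · subst h
    rw [forestCount, Nat.card_eq_one_iff_unique]
    exact ⟨⟨fun x y => Subtype.ext (Prod.ext (Subsingleton.elim _ _) (Subsingleton.elim _ _))⟩,
      ⟨⟨(⊥, 1), by simp, ⟨by simp, by simp, by simp⟩, by simp⟩⟩⟩
  · rw [forestCount, Nat.card_eq_zero]
    left
    rw [isEmpty_subtype]
    rintro x ⟨-, -, h1⟩
    rw [Nat.card_of_isEmpty] at h1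
    omega

section
variable {V : Type*} {G : SimpleGraph V} {σ τ : Equiv.Perm V}

/-- The edges joining each vertex moved by `σ` to its image. -/
def edgesOf (σ : Equiv.Perm V) : Set (Sym2 V) := {e | ∃ v, σ v ≠ v ∧ s(v, σ v) = e}

lemma mk_mem_edgesOf (hσ : ∀ v, σ (σ v) = v) {u v : V} :
    s(u, v) ∈ edgesOf σ ↔ σ u = v ∧ u ≠ v := by
  constructor
  · rintro ⟨w, hw, h⟩
    rcases Sym2.eq_iff.1 h with ⟨rfl, rfl⟩ | ⟨rfl, rfl⟩
    · exact ⟨rfl, hw.symm⟩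
    · exact ⟨hσ w, hw⟩
  · rintro ⟨rfl, h⟩
    exact ⟨u, h.symm, rfl⟩

lemma edgesOf_inj (hσ : ∀ v, σ (σ v) = v) (hτ : ∀ v, τ (τ v) = v) (h : edgesOf σ = edgesOf τ) :
    σ = τ := by
  ext v
  by_cases hv : σ v = v
  · by_contra hne
    have h1 : s(v, τ v) ∈ edgesOf τ := ⟨v, fun h' => hne (by rw [hv, h']), rfl⟩
    rw [← h, mk_mem_edgesOf hσ] at h1
    exact hne h1.1
  · have h1 : s(v, σ v) ∈ edgesOf σ := ⟨v, hv, rfl⟩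
    rw [h, mk_mem_edgesOf hτ] at h1
    exact h1.1.symm

lemma MatchedBy.isMaximalMatching (h : MatchedBy G σ) : IsMaximalMatching G (edgesOf σ) := by
  obtain ⟨h1, h2, h3⟩ := h
  refine ⟨⟨?_, ?_⟩, ?_⟩
  · rintro _ ⟨v, hv, rfl⟩
    exact h2 v hv
  · intro e he f hf hne v hve hvf
    obtain ⟨w, rfl⟩ := hve
    obtain ⟨w', rfl⟩ := hvf
    rw [mk_mem_edgesOf h1] at he hf
    exact hne (by rw [← he.1, ← hf.1])
  · rintro M' ⟨hM1, hM2⟩ ⟨hsub, hnot⟩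
    obtain ⟨e, he, hne⟩ := Set.not_subset.1 hnot
    have key : ∀ u ∈ e, σ u = u := by
      intro u hu
      by_contra hu'
      have h4 : s(u, σ u) ∈ edgesOf σ := ⟨u, hu', rfl⟩
      exact hM2 _ he _ (hsub h4) (fun h5 => hne (h5 ▸ h4)) u hu (Sym2.mem_mk_left _ _)
    induction e with
    | h u v => exact h3 u v (hM1 he) (key u (by simp)) (key v (by simp))

lemma IsMaximalMatching.exists_matchedBy {M : Set (Sym2 V)} (h : IsMaximalMatching G M) :
    ∃ σ, MatchedBy G σ ∧ edgesOf σ = M := by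
  classical
  obtain ⟨⟨h1, h2⟩, h3⟩ := h
  have huniq : ∀ v w w', s(v, w) ∈ M → s(v, w') ∈ M → w = w' := by
    intro v w w' hw hw'
    by_contra hne
    exact h2 _ hw _ hw' (fun h => hne (Sym2.congr_right.1 h)) v (by simp) (by simp)
  set f : V → V := fun v => if h : ∃ w, s(v, w) ∈ M then h.choose else v with hf
  have hf1 : ∀ v w, s(v, w) ∈ M → f v = w := by
    intro v w hw
    have h : ∃ w, s(v, w) ∈ M := ⟨w, hw⟩
    simp only [hf, dif_pos h]
    exact huniq _ _ _ h.choose_spec hw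
  have hf2 : ∀ v, f v ≠ v → s(v, f v) ∈ M := by
    intro v hv
    by_cases h : ∃ w, s(v, w) ∈ M
    · obtain ⟨w, hw⟩ := h
      rwa [hf1 v w hw]
    · exact (hv (by simp only [hf, dif_neg h])).elim
  have hinv : Function.Involutive f := by
    intro v
    by_cases hv : f v = v
    · rw [hv, hv]
    · exact hf1 _ _ (Sym2.eq_swap ▸ hf2 v hv)
  have hne : ∀ v, s(v, v) ∉ M := fun v hv => G.loopless.irrefl v (h1 hv)
  refine ⟨hinv.toPerm, ⟨hinv, fun v hv => h1 (hf2 v hv), ?_⟩, ?_⟩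
  · intro u v huv hu hv
    change f u = u at hu
    change f v = v at hv
    have key : ∀ x ∈ s(u, v), ∀ e ∈ M, x ∉ e := by
      rintro x hx e he ⟨y, rfl⟩
      have h4 := hf1 _ _ he
      have h5 : f x = x := by
        rcases Sym2.mem_iff.1 hx with rfl | rfl
        · exact hu
        · exact hv
      rw [← h4, h5] at he
      exact hne _ he
    refine h3 (insert s(u, v) M) ⟨Set.insert_subset huv h1, ?_⟩ (Set.ssubset_insert ?_)
    · rintro e (rfl | he) e' (rfl | he') hee x hx hx'
      · exact hee rfl
      · exact key x hx e' he' hx'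
      · exact key x hx' e he hx
      · exact h2 e he e' he' hee x hx hx'
    · exact fun h4 => key u (by simp) _ h4 (by simp)
  · ext e
    induction e with
    | h u v =>
      rw [mk_mem_edgesOf (σ := hinv.toPerm) hinv]
      change f u = v ∧ u ≠ v ↔ _
      constructor
      · rintro ⟨rfl, h⟩
        exact hf2 u h.symm
      · intro h
        exact ⟨hf1 u v h, fun h' => hne v (h' ▸ h)⟩

lemma two_mul_ncard_edgesOf [Finite V] (hσ : ∀ v, σ (σ v) = v) :
    2 * (edgesOf σ).ncard = Nat.card {v // σ v ≠ v} := by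
  classical
  have := Fintype.ofFinite V
  have h1 : edgesOf σ = ((Finset.univ.filter fun v => σ v ≠ v).image fun v => s(v, σ v) :) := by
    ext e
    simp [edgesOf]
  rw [h1, Set.ncard_coe_finset, Nat.card_eq_fintype_card, Fintype.card_subtype,
    Finset.card_eq_sum_card_image (fun v => s(v, σ v)) (Finset.univ.filter fun v => σ v ≠ v),
    Finset.sum_const_nat (m := 2), mul_comm]
  simp only [Finset.mem_image, Finset.mem_filter, Finset.mem_univ, true_and, forall_exists_index,
    and_imp, forall_apply_eq_imp_iff₂, Finset.filter_filter]
  intro v hv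
  rw [Finset.card_eq_two]
  refine ⟨v, σ v, Ne.symm hv, ?_⟩
  ext w
  simp only [Finset.mem_filter, Finset.mem_univ, true_and, Finset.mem_insert,
    Finset.mem_singleton, Sym2.eq_iff]
  constructor
  · rintro ⟨-, h | h⟩
    · exact Or.inl h.1
    · exact Or.inr h.1
  · rintro (rfl | rfl)
    · exact ⟨hv, Or.inl ⟨rfl, rfl⟩⟩
    · exact ⟨by rw [hσ]; exact Ne.symm hv, Or.inr ⟨rfl, hσ v⟩⟩

end

instance (n : ℕ) : Finite (MMSpace n) := by
  unfold MMSpace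
  infer_instance

lemma card_MMSpace_ncard (n k : ℕ) :
    Nat.card {p : MMSpace n // p.val.2.ncard = k} = forestCount (Fin n) k := by
  symm
  refine Nat.card_congr (Equiv.ofBijective (fun x => ⟨⟨(x.1.1, edgesOf x.1.2), x.2.1,
    x.2.2.1.isMaximalMatching⟩, ?_⟩) ⟨?_, ?_⟩)
  · have h1 := two_mul_ncard_edgesOf x.2.2.1.1
    have h2 := x.2.2.2
    change (edgesOf x.1.2).ncard = k
    omega
  · rintro ⟨⟨G, σ⟩, h1, h2, h3⟩ ⟨⟨G', σ'⟩, h1', h2', h3'⟩ h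
    have h4 : (G, edgesOf σ) = (G', edgesOf σ') := congrArg (fun p => p.1.1) h
    rw [Prod.mk.injEq] at h4
    exact Subtype.ext (Prod.ext h4.1 (edgesOf_inj h2.1 h2'.1 h4.2))
  · rintro ⟨⟨⟨G, M⟩, h1, h2⟩, h3⟩
    obtain ⟨σ, h4, rfl⟩ := h2.exists_matchedBy
    refine ⟨⟨(G, σ), h1, h4, ?_⟩, rfl⟩
    rw [← two_mul_ncard_edgesOf h4.1]
    exact congrArg _ h3

lemma forestCount_eq_zero {n k : ℕ} (h : n < 2 * k) : forestCount (Fin n) k = 0 := by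
  classical
  rw [forestCount, Nat.card_eq_zero]
  left
  rw [isEmpty_subtype]
  rintro x ⟨-, -, h'⟩
  have h1 := Fintype.card_subtype_le fun v => x.2 v ≠ v
  rw [← Nat.card_eq_fintype_card, h', Fintype.card_fin] at h1
  omega

lemma finsum_MMSpace (n : ℕ) (f : ℕ → ℝ) :
    ∑ᶠ p : MMSpace n, f p.val.2.ncard =
      ∑ k ∈ Finset.range (n + 1), f k * forestCount (Fin n) k := by
  classical
  have := Fintype.ofFinite (MMSpace n)
  rw [finsum_eq_sum_of_fintype,
    ← Finset.sum_fiberwise_of_maps_to (g := fun p : MMSpace n => p.val.2.ncard)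
      (t := Finset.range (n + 1))]
  · refine Finset.sum_congr rfl fun k _ => ?_
    rw [Finset.sum_congr rfl (g := fun _ => f k)
      (fun p hp => by rw [(Finset.mem_filter.1 hp).2]), Finset.sum_const, nsmul_eq_mul,
      ← card_MMSpace_ncard, Nat.card_eq_fintype_card, Fintype.card_subtype, mul_comm]
  · intro p _
    by_contra hp
    rw [Finset.mem_range] at hp
    have h0 : forestCount (Fin n) p.val.2.ncard = 0 := forestCount_eq_zero (by omega)
    rw [← card_MMSpace_ncard, Nat.card_eq_zero] at h0
    rcases h0 with h0 | h0
    · exact h0.false ⟨p, rfl⟩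
    · exact h0.not_finite inferInstance

lemma mN_eq_sum (n : ℕ) :
    (mN n : ℝ) = ∑ k ∈ Finset.range (n + 1), (forestCount (Fin n) k : ℝ) := by
  have := Fintype.ofFinite (MMSpace n)
  have h := finsum_MMSpace n fun _ => 1
  rw [finsum_eq_sum_of_fintype] at h
  simpa [mN] using h

lemma card_MMSpace_le (n : ℕ) (y : ℝ) :
    (Nat.card {p : MMSpace n // (p.val.2.ncard : ℝ) ≤ y} : ℝ) =
      ∑ k ∈ Finset.range (n + 1), (if (k : ℝ) ≤ y then 1 else 0) * (forestCount (Fin n) k : ℝ) := by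
  classical
  have := Fintype.ofFinite (MMSpace n)
  rw [← finsum_MMSpace n fun k => if (k : ℝ) ≤ y then 1 else 0, finsum_eq_sum_of_fintype,
    Nat.card_eq_fintype_card, Fintype.card_subtype]
  simp

lemma summable_of_mul_le_conv {A D : ℕ → ℝ} (hA0 : ∀ n, 0 ≤ A n) (hD0 : ∀ n, 0 ≤ D n)
    (hA : Summable A)
    (h : ∀ n : ℕ, n * D n ≤ ∑ s ∈ Finset.range (n + 1), s * A s * D (n - s)) : Summable D := by
  have hT : Tendsto (fun n : ℕ => ∑' s : ℕ, min ((s : ℝ) / n) 1 * A s) atTop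
      (𝓝 (∑' _s : ℕ, 0)) := by
    refine tendsto_tsum_of_dominated_convergence hA (fun s => ?_)
      (Eventually.of_forall fun n s => ?_)
    · have h1 : Tendsto (fun n : ℕ => min ((s : ℝ) / n) 1 * A s) atTop (𝓝 (min 0 1 * A s)) :=
        ((tendsto_const_div_atTop_nhds_zero_nat (s : ℝ)).min tendsto_const_nhds).mul_const _
      simpa using h1
    · rw [Real.norm_of_nonneg (mul_nonneg (le_min (by positivity) zero_le_one) (hA0 s))]
      exact mul_le_of_le_one_left (hA0 s) (min_le_right _ _)
  rw [tsum_zero] at hT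
  obtain ⟨n₀, hn₀, hn₀'⟩ :=
    ((hT.eventually_le_const (show (0 : ℝ) < 1 / 2 by norm_num)).and (eventually_ge_atTop 1)).exists
  set g : ℕ → ℝ := fun s => min ((s : ℝ) / n₀) 1 * A s with hg
  have hg0 : ∀ s, 0 ≤ g s := fun s =>
    mul_nonneg (le_min (by positivity) zero_le_one) (hA0 s)
  have hgs : Summable g := by
    refine Summable.of_nonneg_of_le hg0 (fun s => ?_) hA
    exact mul_le_of_le_one_left (hA0 s) (min_le_right _ _)
  have hconv0 : ∀ n, 0 ≤ ∑ s ∈ Finset.range (n + 1), g s * D (n - s) := fun n =>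
    Finset.sum_nonneg fun s _ => mul_nonneg (hg0 s) (hD0 _)
  have hpt : ∀ n, D n ≤ (if n < n₀ then D n else 0) +
      ∑ s ∈ Finset.range (n + 1), g s * D (n - s) := by
    intro n
    split_ifs with hn
    · linarith [hconv0 n]
    · rw [zero_add]
      have hn1 : (0 : ℝ) < n := by
        have : 0 < n := by omega
        exact_mod_cast this
      have h1 : D n ≤ (∑ s ∈ Finset.range (n + 1), s * A s * D (n - s)) / n := by
        rw [le_div_iff₀ hn1, mul_comm]
        exact h n
      refine h1.trans ?_
      rw [Finset.sum_div]
      refine Finset.sum_le_sum fun s hs => ?_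
      have h2 : (s : ℝ) ≤ n := by
        have := Finset.mem_range.1 hs
        exact_mod_cast (by omega : s ≤ n)
      have h3 : (n₀ : ℝ) ≤ n := by exact_mod_cast not_lt.1 hn
      have h4 : (0 : ℝ) < n₀ := by exact_mod_cast hn₀'
      have h5 : (s : ℝ) / n ≤ min ((s : ℝ) / n₀) 1 :=
        le_min (by gcongr) ((div_le_one hn1).2 h2)
      calc s * A s * D (n - s) / n = (s / n : ℝ) * A s * D (n - s) := by ring
        _ ≤ _ := by
          have := hA0 s
          have := hD0 (n - s)
          simp only [hg]
          gcongr
  refine summable_of_sum_range_le (c := 2 * ∑ n ∈ Finset.range n₀, D n) hD0 fun N => ?_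
  have h1 : ∑ n ∈ Finset.range N, (if n < n₀ then D n else 0) ≤ ∑ n ∈ Finset.range n₀, D n := by
    rw [← Finset.sum_filter]
    refine Finset.sum_le_sum_of_subset_of_nonneg (fun n hn => ?_) fun n _ _ => hD0 n
    simp at hn ⊢
    omega
  have h2 : ∑ n ∈ Finset.range N, ∑ s ∈ Finset.range (n + 1), g s * D (n - s) ≤
      1 / 2 * ∑ n ∈ Finset.range N, D n := by
    rw [Finset.sum_range_diag_flip N fun s m => g s * D m]
    calc _ ≤ ∑ s ∈ Finset.range N, g s * ∑ n ∈ Finset.range N, D n := by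
          refine Finset.sum_le_sum fun s _ => ?_
          rw [← Finset.mul_sum]
          refine mul_le_mul_of_nonneg_left ?_ (hg0 s)
          exact Finset.sum_le_sum_of_subset_of_nonneg
            (Finset.range_subset_range.2 (by omega)) fun n _ _ => hD0 n
      _ = (∑ s ∈ Finset.range N, g s) * ∑ n ∈ Finset.range N, D n := by rw [Finset.sum_mul]
      _ ≤ _ := mul_le_mul_of_nonneg_right
          ((hgs.sum_le_tsum _ fun s _ => hg0 s).trans hn₀) (Finset.sum_nonneg fun n _ => hD0 n)
  have h3 := Finset.sum_le_sum fun n (_ : n ∈ Finset.range N) => hpt n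
  rw [Finset.sum_add_distrib] at h3
  linarith

lemma sum_range_le_of_support {f : ℕ → ℝ} (hf : ∀ k, 0 ≤ f k) {n : ℕ} (hfn : ∀ k, n < k → f k = 0)
    (N : ℕ) : ∑ k ∈ Finset.range N, f k ≤ ∑ k ∈ Finset.range (n + 1), f k := by
  rcases le_total N (n + 1) with h | h
  · exact Finset.sum_le_sum_of_subset_of_nonneg (Finset.range_subset_range.2 h) fun k _ _ => hf k
  · refine (Finset.sum_subset (Finset.range_subset_range.2 h) fun k _ hk => hfn k ?_).ge
    rw [Finset.mem_range] at hk
    omega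

section
variable {a b : ℕ → ℕ → ℝ} {C : ℝ}

lemma sum_range_le_of_cubic (hb0 : ∀ n k, 0 ≤ b n k) (hC : 0 ≤ C)
    (hb : ∀ n k, 1 ≤ n → b n k ≤ C / (n : ℝ) ^ 3) (hbs : ∀ n k, n < k → b n k = 0)
    {n : ℕ} (hn : 1 ≤ n) (N : ℕ) :
    ∑ k ∈ Finset.range N, b n k ≤ 2 * C / (n : ℝ) ^ 2 := by
  have hn' : (1 : ℝ) ≤ n := by exact_mod_cast hn
  calc ∑ k ∈ Finset.range N, b n k ≤ ∑ k ∈ Finset.range (n + 1), b n k :=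
        sum_range_le_of_support (hb0 n) (hbs n) N
    _ ≤ ∑ k ∈ Finset.range (n + 1), C / (n : ℝ) ^ 3 := Finset.sum_le_sum fun k _ => hb n k hn
    _ = (n + 1) * (C / (n : ℝ) ^ 3) := by simp
    _ ≤ (2 * n) * (C / (n : ℝ) ^ 3) := by gcongr; linarith
    _ = 2 * C / (n : ℝ) ^ 2 := by field_simp

lemma tendsto_sum_div_of_sq (C : ℝ) : Tendsto (fun n : ℕ =>
    (∑ s ∈ Finset.range n, (s : ℝ) * (2 * C / (s : ℝ) ^ 2)) / (n : ℝ)) atTop (𝓝 0) := by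
  have h1 : Tendsto (fun s : ℕ => (s : ℝ) * (2 * C / (s : ℝ) ^ 2)) atTop (𝓝 0) := by
    refine (tendsto_const_div_atTop_nhds_zero_nat (2 * C)).congr fun s => ?_
    rcases eq_or_ne s 0 with rfl | hs
    · simp
    · field_simp
  refine h1.cesaro.congr fun n => ?_
  rw [div_eq_inv_mul]

lemma summable_row_sums (ha0 : ∀ n k, 0 ≤ a n k) (hb0 : ∀ n k, 0 ≤ b n k) (hC : 0 ≤ C)
    (ha : ∀ n k, 1 ≤ n → a n k ≤ C / (n : ℝ) ^ 3) (has : ∀ n k, n < k → a n k = 0)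
    (hbs : ∀ n k, n < k → b n k = 0)
    (hrec : ∀ n k : ℕ, n * b n k ≤ ∑ s ∈ Finset.range (n + 1), s *
      ∑ i ∈ Finset.range (k + 1), a s i * b (n - s) (k - i)) :
    Summable fun n => ∑ k ∈ Finset.range (n + 1), b n k := by
  refine summable_of_mul_le_conv (A := fun s => 2 * C / (s : ℝ) ^ 2) (fun s => by positivity)
    (fun n => Finset.sum_nonneg fun k _ => hb0 n k) ?_ fun n => ?_
  · simp_rw [div_eq_mul_inv]
    exact (Real.summable_nat_pow_inv.2 one_lt_two).mul_left _
  · rw [Finset.mul_sum]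
    refine (Finset.sum_le_sum fun k _ => hrec n k).trans ?_
    rw [Finset.sum_comm]
    refine Finset.sum_le_sum fun s _ => ?_
    rw [← Finset.mul_sum, mul_assoc]
    rcases Nat.eq_zero_or_pos s with rfl | hs
    · simp
    refine mul_le_mul_of_nonneg_left ?_ (Nat.cast_nonneg s)
    rw [Finset.sum_range_diag_flip (n + 1) fun i j => a s i * b (n - s) j]
    calc _ ≤ ∑ i ∈ Finset.range (n + 1), a s i * ∑ k ∈ Finset.range (n - s + 1), b (n - s) k := by
          refine Finset.sum_le_sum fun i _ => ?_
          rw [← Finset.mul_sum]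
          refine mul_le_mul_of_nonneg_left ?_ (ha0 s i)
          exact sum_range_le_of_support (hb0 _) (hbs _) _
      _ = (∑ i ∈ Finset.range (n + 1), a s i) * ∑ k ∈ Finset.range (n - s + 1), b (n - s) k := by
          rw [Finset.sum_mul]
      _ ≤ _ := mul_le_mul_of_nonneg_right (sum_range_le_of_cubic ha0 hC ha has hs _)
          (Finset.sum_nonneg fun k _ => hb0 _ k)

lemma sum_conv_le_of_le (ha0 : ∀ n k, 0 ≤ a n k) (hC : 0 ≤ C)
    (ha : ∀ n k, 1 ≤ n → a n k ≤ C / (n : ℝ) ^ 3) (has : ∀ n k, n < k → a n k = 0)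
    {K : ℝ} (hK : 0 ≤ K) {n : ℕ}
    (hb : ∀ m k, 1 ≤ m → m < n → b m k ≤ K / (m : ℝ) ^ 3) (k : ℕ) :
    ∑ s ∈ Finset.range ((n + 1) / 2), s * ∑ i ∈ Finset.range (k + 1), a s i * b (n - s) (k - i) ≤
      (∑ s ∈ Finset.range n, (s : ℝ) * (2 * C / (s : ℝ) ^ 2)) * (8 * K / (n : ℝ) ^ 3) := by
  rw [Finset.sum_mul]
  calc _ ≤ ∑ s ∈ Finset.range ((n + 1) / 2), s * (2 * C / (s : ℝ) ^ 2) * (8 * K / (n : ℝ) ^ 3) := by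
        refine Finset.sum_le_sum fun s hs => ?_
        rcases Nat.eq_zero_or_pos s with rfl | hs0
        · simp
        rw [Finset.mem_range] at hs
        have h1 : (n : ℝ) / 2 ≤ (n - s : ℕ) := by
          rw [div_le_iff₀ two_pos]
          exact_mod_cast (by omega : n ≤ (n - s) * 2)
        have hn : (0 : ℝ) < n := by exact_mod_cast (by omega : 0 < n)
        have h2 : ∀ j, b (n - s) j ≤ 8 * K / (n : ℝ) ^ 3 := by
          intro j
          refine (hb (n - s) j (by omega) (by omega)).trans ?_
          calc K / ((n - s : ℕ) : ℝ) ^ 3 ≤ K / ((n : ℝ) / 2) ^ 3 := by gcongr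
            _ = _ := by field_simp; ring
        rw [mul_assoc]
        refine mul_le_mul_of_nonneg_left ?_ (Nat.cast_nonneg s)
        calc _ ≤ ∑ i ∈ Finset.range (k + 1), a s i * (8 * K / (n : ℝ) ^ 3) :=
              Finset.sum_le_sum fun i _ => mul_le_mul_of_nonneg_left (h2 _) (ha0 s i)
          _ = (∑ i ∈ Finset.range (k + 1), a s i) * (8 * K / (n : ℝ) ^ 3) := by rw [Finset.sum_mul]
          _ ≤ _ := mul_le_mul_of_nonneg_right (sum_range_le_of_cubic ha0 hC ha has hs0 _)
              (by positivity)
    _ ≤ _ := Finset.sum_le_sum_of_subset_of_nonneg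
        (Finset.range_subset_range.2 (by omega)) fun s _ _ => by positivity

lemma sum_Ico_conv_eq (n k : ℕ) :
    ∑ s ∈ Finset.range (n + 1), s * ∑ i ∈ Finset.range (k + 1), a s i * b (n - s) (k - i) =
      ∑ s ∈ Finset.range ((n + 1) / 2), s *
        ∑ i ∈ Finset.range (k + 1), a s i * b (n - s) (k - i) +
      ∑ m ∈ Finset.range (n / 2 + 1), (n - m : ℕ) *
        ∑ i ∈ Finset.range (k + 1), a (n - m) (k - i) * b m i := by
  rw [← Finset.sum_range_add_sum_Ico _ (show (n + 1) / 2 ≤ n + 1 by omega)]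
  congr 1
  refine Finset.sum_bij' (fun s _ => n - s) (fun m _ => n - m) ?_ ?_ ?_ ?_ ?_
  · intro s hs
    rw [Finset.mem_Ico] at hs
    rw [Finset.mem_range]
    omega
  · intro m hm
    rw [Finset.mem_range] at hm
    rw [Finset.mem_Ico]
    omega
  · intro s hs
    rw [Finset.mem_Ico] at hs
    omega
  · intro m hm
    rw [Finset.mem_range] at hm
    omega
  · intro s hs
    rw [Finset.mem_Ico] at hs
    rw [Nat.sub_sub_self (by omega : s ≤ n),
      ← Finset.sum_flip fun i => a s i * b (n - s) (k - i)]
    congr 1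
    refine Finset.sum_congr rfl fun i hi => ?_
    rw [Finset.mem_range] at hi
    rw [Nat.sub_sub_self (by omega : i ≤ k)]

lemma mul_conv_le (hb0 : ∀ n k, 0 ≤ b n k)
    (ha : ∀ n k, 1 ≤ n → a n k ≤ C / (n : ℝ) ^ 3)
    (hC : 0 ≤ C) (hbs : ∀ n k, n < k → b n k = 0) {n m : ℕ} (hn : 1 ≤ n) (hm : m < n / 2 + 1)
    (k : ℕ) : (n - m : ℕ) * ∑ i ∈ Finset.range (k + 1), a (n - m) (k - i) * b m i ≤
      4 * C / (n : ℝ) ^ 2 * ∑ i ∈ Finset.range (m + 1), b m i := by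
  have h1 : (n : ℝ) / 2 ≤ (n - m : ℕ) := by
    rw [div_le_iff₀ two_pos]
    exact_mod_cast (by omega : n ≤ (n - m) * 2)
  have hn0 : (0 : ℝ) < n := by exact_mod_cast hn
  have hnm : (0 : ℝ) < (n - m : ℕ) := by linarith [half_pos hn0]
  have h2 : ∀ j, (n - m : ℕ) * a (n - m) j ≤ 4 * C / (n : ℝ) ^ 2 := by
    intro j
    calc (n - m : ℕ) * a (n - m) j ≤ (n - m : ℕ) * (C / ((n - m : ℕ) : ℝ) ^ 3) := by
          have := ha (n - m) j (by omega)
          gcongr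
      _ = C / ((n - m : ℕ) : ℝ) ^ 2 := by field_simp
      _ ≤ C / ((n : ℝ) / 2) ^ 2 := by gcongr
      _ = _ := by field_simp; ring
  rw [Finset.mul_sum, Finset.mul_sum]
  calc _ ≤ ∑ i ∈ Finset.range (k + 1), 4 * C / (n : ℝ) ^ 2 * b m i := by
        refine Finset.sum_le_sum fun i _ => ?_
        rw [← mul_assoc]
        exact mul_le_mul_of_nonneg_right (h2 _) (hb0 _ _)
    _ ≤ _ := by
        rw [← Finset.mul_sum, ← Finset.mul_sum]
        exact mul_le_mul_of_nonneg_left (sum_range_le_of_support (hb0 m) (hbs m) _) (by positivity)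

/-- Cubic decay is inherited by the solution of the convolution inequality. -/
lemma exists_le_div_cube (ha0 : ∀ n k, 0 ≤ a n k) (hb0 : ∀ n k, 0 ≤ b n k) (hC : 0 ≤ C)
    (ha : ∀ n k, 1 ≤ n → a n k ≤ C / (n : ℝ) ^ 3) (has : ∀ n k, n < k → a n k = 0)
    (hbs : ∀ n k, n < k → b n k = 0)
    (hrec : ∀ n k : ℕ, n * b n k ≤ ∑ s ∈ Finset.range (n + 1), s *
      ∑ i ∈ Finset.range (k + 1), a s i * b (n - s) (k - i)) :
    ∃ K, 0 ≤ K ∧ ∀ n k, 1 ≤ n → b n k ≤ K / (n : ℝ) ^ 3 := by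
  have hD := summable_row_sums ha0 hb0 hC ha has hbs hrec
  set D : ℕ → ℝ := fun n => ∑ k ∈ Finset.range (n + 1), b n k with hDdef
  have hD0 : ∀ n, 0 ≤ D n := fun n => Finset.sum_nonneg fun k _ => hb0 n k
  have hbD : ∀ n k, b n k ≤ D n := by
    intro n k
    by_cases h : n < k
    · rw [hbs n k h]
      exact hD0 n
    · exact Finset.single_le_sum (fun k _ => hb0 n k) (Finset.mem_range.2 (by omega))
  obtain ⟨n₀, hn₀⟩ := eventually_atTop.1
    ((tendsto_sum_div_of_sq C).eventually_le_const (show (0 : ℝ) < 1 / 16 by norm_num))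
  have hT0 : 0 ≤ ∑' m, D m := tsum_nonneg hD0
  have hS0 : 0 ≤ ∑ n ∈ Finset.range n₀, (n : ℝ) ^ 3 * D n :=
    Finset.sum_nonneg fun n _ => mul_nonneg (by positivity) (hD0 n)
  set K := 2 * (4 * C * ∑' m, D m) + ∑ n ∈ Finset.range n₀, (n : ℝ) ^ 3 * D n with hK
  have hK0 : 0 ≤ K := by positivity
  refine ⟨K, hK0, fun n => ?_⟩
  induction n using Nat.strong_induction_on with
  | _ n ih =>
  intro k hn
  have hn0 : (0 : ℝ) < n := by exact_mod_cast hn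
  rw [le_div_iff₀ (by positivity)]
  by_cases hlt : n < n₀
  · have h1 : (n : ℝ) ^ 3 * D n ≤ ∑ n ∈ Finset.range n₀, (n : ℝ) ^ 3 * D n :=
      Finset.single_le_sum (f := fun n : ℕ => (n : ℝ) ^ 3 * D n)
        (fun n _ => mul_nonneg (by positivity) (hD0 n)) (Finset.mem_range.2 hlt)
    have h2 : b n k * (n : ℝ) ^ 3 ≤ (n : ℝ) ^ 3 * D n := by
      rw [mul_comm]
      exact mul_le_mul_of_nonneg_left (hbD n k) (by positivity)
    have : 0 ≤ 4 * C * ∑' m, D m := by positivity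
    linarith
  · have h1 := hrec n k
    rw [sum_Ico_conv_eq] at h1
    have h2 := sum_conv_le_of_le (b := b) ha0 hC ha has hK0 (n := n)
      (fun m k hm hmn => ih m hmn k hm) k
    have h3 := hn₀ n (not_lt.1 hlt)
    rw [div_le_iff₀ hn0] at h3
    have h4 : ∑ m ∈ Finset.range (n / 2 + 1), ((n - m : ℕ) : ℝ) *
        ∑ i ∈ Finset.range (k + 1), a (n - m) (k - i) * b m i ≤
        4 * C / (n : ℝ) ^ 2 * ∑' m, D m := by
      refine (Finset.sum_le_sum fun m hm =>
        mul_conv_le hb0 ha hC hbs hn (Finset.mem_range.1 hm) k).trans ?_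
      rw [← Finset.mul_sum]
      exact mul_le_mul_of_nonneg_left (hD.sum_le_tsum _ fun m _ => hD0 m) (by positivity)
    have h5 : (n : ℝ) * b n k ≤ 1 / 16 * n * (8 * K / (n : ℝ) ^ 3) +
        4 * C / (n : ℝ) ^ 2 * ∑' m, D m := by
      refine (h1.trans (add_le_add h2 h4)).trans ?_
      gcongr
    have h6 : (n : ℝ) * b n k * (n : ℝ) ^ 2 ≤ K / 2 + 4 * C * ∑' m, D m := by
      calc (n : ℝ) * b n k * (n : ℝ) ^ 2 ≤ (1 / 16 * n * (8 * K / (n : ℝ) ^ 3) +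
            4 * C / (n : ℝ) ^ 2 * ∑' m, D m) * (n : ℝ) ^ 2 := by gcongr
        _ = _ := by field_simp; ring
    have h7 : b n k * (n : ℝ) ^ 3 = (n : ℝ) * b n k * (n : ℝ) ^ 2 := by ring
    rw [h7]
    linarith

end

lemma add_sq_div_add_le {x y s m : ℝ} (hs : 0 < s) (hm : 0 < m) :
    (x + y) ^ 2 / (s + m) ≤ x ^ 2 / s + y ^ 2 / m := by
  rw [div_add_div _ _ hs.ne' hm.ne', div_le_div_iff₀ (by positivity) (by positivity)]
  nlinarith [sq_nonneg (x * m - y * s)]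

section
variable {α β : ℕ → ℕ → ℝ} {μ : ℝ}

/-- Gaussian tails are inherited by the solution of the convolution equation. -/
lemma exists_gaussian_bound {C c : ℝ} (hα0 : ∀ n k, 0 ≤ α n k) (hβ0 : ∀ n k, 0 ≤ β n k)
    (hC : 0 ≤ C) (hc : 0 < c) (hαs : ∀ n k, n < k → α n k = 0) (hβs : ∀ n k, n < k → β n k = 0)
    (hα : ∀ n k, 1 ≤ n → α n k ≤ C / (n : ℝ) ^ 3 * Real.exp (-c * ((k - μ * n) ^ 2 / n)))
    (hrec : ∀ n k : ℕ, n * β n k = ∑ s ∈ Finset.range (n + 1), s *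
      ∑ i ∈ Finset.range (k + 1), α s i * β (n - s) (k - i)) :
    ∃ K, 0 ≤ K ∧ ∀ n k, 1 ≤ n →
      β n k ≤ K / (n : ℝ) ^ 3 * Real.exp (-(c / 2) * ((k - μ * n) ^ 2 / n)) := by
  set w : ℕ → ℕ → ℝ := fun n k => Real.exp (c / 2 * ((k - μ * n) ^ 2 / n)) with hw
  have hw0 : ∀ n k, 0 < w n k := fun n k => Real.exp_pos _
  have hcube : ∀ n k : ℕ, 1 ≤ n → α n k * w n k ≤ C / (n : ℝ) ^ 3 := by
    intro n k hn
    calc α n k * w n k ≤ C / (n : ℝ) ^ 3 * Real.exp (-c * ((k - μ * n) ^ 2 / n)) * w n k :=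
          mul_le_mul_of_nonneg_right (hα n k hn) (hw0 n k).le
      _ = C / (n : ℝ) ^ 3 * Real.exp (-(c / 2) * ((k - μ * n) ^ 2 / n)) := by
          rw [mul_assoc, hw, ← Real.exp_add]
          ring_nf
      _ ≤ C / (n : ℝ) ^ 3 * 1 := by
          refine mul_le_mul_of_nonneg_left ?_ (by positivity)
          rw [Real.exp_le_one_iff, neg_mul, neg_nonpos]
          positivity
      _ = _ := mul_one _
  have hconv : ∀ n k : ℕ, n * (β n k * w n k) ≤ ∑ s ∈ Finset.range (n + 1), s *
      ∑ i ∈ Finset.range (k + 1), α s i * w s i * (β (n - s) (k - i) * w (n - s) (k - i)) := by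
    intro n k
    rw [← mul_assoc, hrec, Finset.sum_mul]
    refine Finset.sum_le_sum fun s hs => ?_
    rw [mul_assoc]
    refine mul_le_mul_of_nonneg_left ?_ (Nat.cast_nonneg s)
    rw [Finset.sum_mul]
    refine Finset.sum_le_sum fun i hi => ?_
    rw [Finset.mem_range] at hs hi
    by_cases h0 : α s i * β (n - s) (k - i) = 0
    · rw [h0, zero_mul]
      have := mul_nonneg (hα0 s i) (hw0 s i).le
      have := mul_nonneg (hβ0 (n - s) (k - i)) (hw0 (n - s) (k - i)).le
      positivity
    have hβne := right_ne_zero_of_mul h0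
    have hαne := left_ne_zero_of_mul h0
    have hwle : w n k ≤ w s i * w (n - s) (k - i) := by
      rw [hw, ← Real.exp_add, Real.exp_le_exp, ← mul_add]
      refine mul_le_mul_of_nonneg_left ?_ (half_pos hc).le
      rcases Nat.eq_zero_or_pos s with rfl | hs0
      · have : i = 0 := by
          by_contra hi0
          exact hαne (hαs 0 i (by omega))
        subst this
        simp
      rcases Nat.eq_zero_or_pos (n - s) with hns | hns
      · have hki : k - i = 0 := by
          by_contra hi0
          exact hβne (hβs _ _ (by omega))
        have h1 : s = n := by omega
        have h2 : i = k := by omega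
        subst h1 h2
        simp
      · have h1 : (n : ℝ) = s + (n - s : ℕ) := by
          rw [← Nat.cast_add]
          congr 1
          omega
        have h2 : (k : ℝ) = i + (k - i : ℕ) := by
          rw [← Nat.cast_add]
          congr 1
          omega
        have h3 := add_sq_div_add_le (x := i - μ * s) (y := ((k - i : ℕ) : ℝ) - μ * (n - s : ℕ))
          (s := s) (m := (n - s : ℕ)) (by exact_mod_cast hs0) (by exact_mod_cast hns)
        refine le_trans (le_of_eq ?_) h3
        rw [← h1]
        congr 2
        rw [h2, h1]
        ring
    calc α s i * β (n - s) (k - i) * w n k ≤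
          α s i * β (n - s) (k - i) * (w s i * w (n - s) (k - i)) :=
          mul_le_mul_of_nonneg_left hwle (mul_nonneg (hα0 _ _) (hβ0 _ _))
      _ = _ := by ring
  obtain ⟨K, hK0, hK⟩ := exists_le_div_cube (a := fun n k => α n k * w n k)
    (b := fun n k => β n k * w n k) (C := C) (fun n k => mul_nonneg (hα0 n k) (hw0 n k).le)
    (fun n k => mul_nonneg (hβ0 n k) (hw0 n k).le) hC hcube
    (fun n k h => by simp [hαs n k h]) (fun n k h => by simp [hβs n k h]) hconv
  refine ⟨K, hK0, fun n k hn => ?_⟩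
  have h := hK n k hn
  rw [neg_mul, Real.exp_neg, ← div_eq_mul_inv, le_div_iff₀ (Real.exp_pos _)]
  exact h

lemma tendsto_div_sqrt_atTop (a : ℝ) :
    Tendsto (fun n : ℕ => a / √(n : ℝ)) atTop (𝓝 0) :=
  tendsto_const_nhds.div_atTop (Real.tendsto_sqrt_atTop.comp tendsto_natCast_atTop_atTop)

lemma tendsto_atTop_of_centered (hμ : 0 < μ) {k : ℕ → ℕ} {x : ℝ}
    (hk : Tendsto (fun n : ℕ => ((k n : ℝ) - μ * n) / √n) atTop (𝓝 x)) :
    Tendsto k atTop atTop := by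
  rw [← tendsto_natCast_atTop_iff (R := ℝ)]
  have h1 : Tendsto (fun n : ℕ => (((k n : ℝ) - μ * n) / √n) * (1 / √n) + μ) atTop
      (𝓝 (x * 0 + μ)) := (hk.mul (tendsto_div_sqrt_atTop 1)).add_const μ
  rw [mul_zero, zero_add] at h1
  refine (h1.pos_mul_atTop hμ tendsto_natCast_atTop_atTop).congr' ?_
  filter_upwards [eventually_gt_atTop 0] with n hn
  have hn' : (0 : ℝ) < n := by exact_mod_cast hn
  rw [div_mul_div_comm, Real.mul_self_sqrt hn'.le]
  field_simp
  ring

lemma tendsto_centered_shift (hμ : 0 < μ) {k : ℕ → ℕ} {x : ℝ}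
    (hk : Tendsto (fun n : ℕ => ((k n : ℝ) - μ * n) / √n) atTop (𝓝 x)) (m i : ℕ) :
    Tendsto (fun n : ℕ => (((k (n + m) - i : ℕ) : ℝ) - μ * n) / √n) atTop (𝓝 x) := by
  have h1 : Tendsto (fun n : ℕ => √(1 + (m : ℝ) / n)) atTop (𝓝 1) := by
    have := ((tendsto_const_div_atTop_nhds_zero_nat (m : ℝ)).const_add 1).sqrt
    simpa using this
  have h2 := ((hk.comp (tendsto_add_atTop_nat m)).mul h1).add (tendsto_div_sqrt_atTop (μ * m - i))
  rw [mul_one, add_zero] at h2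
  refine h2.congr' ?_
  filter_upwards [eventually_gt_atTop 0, ((tendsto_atTop_of_centered hμ hk).comp
    (tendsto_add_atTop_nat m)).eventually_ge_atTop i] with n hn hi
  have hn' : (0 : ℝ) < n := by exact_mod_cast hn
  have h3 : √(1 + (m : ℝ) / n) = √((n + m : ℕ) : ℝ) / √n := by
    rw [← Real.sqrt_div' _ hn'.le]
    congr 1
    push_cast
    field_simp
  have h4 : 0 < √((n + m : ℕ) : ℝ) := Real.sqrt_pos.2 (by positivity)
  have h5 : 0 < √(n : ℝ) := Real.sqrt_pos.2 hn'
  simp only [Function.comp_apply] at hi ⊢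
  rw [h3, Nat.cast_sub hi]
  field_simp
  push_cast
  ring

/-- A local limit theorem is inherited by the solution of the convolution equation. -/
lemma local_limit {C K : ℝ} {γ : ℝ → ℝ} (hα0 : ∀ n k, 0 ≤ α n k) (hβ0 : ∀ n k, 0 ≤ β n k)
    (hC : 0 ≤ C) (hK : 0 ≤ K) (hαs : ∀ n k, n < k → α n k = 0) (hβs : ∀ n k, n < k → β n k = 0)
    (hα : ∀ n k, 1 ≤ n → α n k ≤ C / (n : ℝ) ^ 3) (hβ : ∀ n k, 1 ≤ n → β n k ≤ K / (n : ℝ) ^ 3)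
    (hrec : ∀ n k : ℕ, n * β n k = ∑ s ∈ Finset.range (n + 1), s *
      ∑ i ∈ Finset.range (k + 1), α s i * β (n - s) (k - i)) (hμ : 0 < μ)
    (hlim : ∀ (k : ℕ → ℕ) (x : ℝ), Tendsto (fun n : ℕ => ((k n : ℝ) - μ * n) / √n) atTop (𝓝 x) →
      Tendsto (fun n : ℕ => (n : ℝ) ^ 3 * α n (k n)) atTop (𝓝 (γ x)))
    {k : ℕ → ℕ} {x : ℝ}
    (hk : Tendsto (fun n : ℕ => ((k n : ℝ) - μ * n) / √n) atTop (𝓝 x)) :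
    Tendsto (fun n : ℕ => (n : ℝ) ^ 3 * β n (k n)) atTop
      (𝓝 ((∑' m, ∑ i ∈ Finset.range (m + 1), β m i) * γ x)) := by
  have hD := summable_row_sums hα0 hβ0 hC hα hαs hβs fun n k => (hrec n k).le
  have hsmall : Tendsto (fun n : ℕ => (n : ℝ) ^ 2 * ∑ s ∈ Finset.range ((n + 1) / 2), s *
      ∑ i ∈ Finset.range (k n + 1), α s i * β (n - s) (k n - i)) atTop (𝓝 0) := by
    have h1 := (tendsto_sum_div_of_sq C).mul_const (8 * K)
    rw [zero_mul] at h1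
    refine squeeze_zero' (Eventually.of_forall fun n => ?_) ?_ h1
    · refine mul_nonneg (by positivity) (Finset.sum_nonneg fun s _ => ?_)
      exact mul_nonneg (Nat.cast_nonneg s)
        (Finset.sum_nonneg fun i _ => mul_nonneg (hα0 _ _) (hβ0 _ _))
    · filter_upwards [eventually_gt_atTop 0] with n hn
      have hn' : (0 : ℝ) < n := by exact_mod_cast hn
      have h2 := sum_conv_le_of_le (b := β) hα0 hC hα hαs hK (n := n)
        (fun m k hm _ => hβ m k hm) (k n)
      calc _ ≤ (n : ℝ) ^ 2 * ((∑ s ∈ Finset.range n, (s : ℝ) * (2 * C / (s : ℝ) ^ 2)) *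
            (8 * K / (n : ℝ) ^ 3)) := by gcongr
        _ = _ := by field_simp
  set F : ℕ → ℕ → ℝ := fun n m => if m < n / 2 + 1 then (n : ℝ) ^ 2 * ((n - m : ℕ) *
    ∑ i ∈ Finset.range (k n + 1), α (n - m) (k n - i) * β m i) else 0 with hF
  have hmain : Tendsto (fun n => ∑' m, F n m) atTop
      (𝓝 (∑' m, (∑ i ∈ Finset.range (m + 1), β m i) * γ x)) := by
    refine tendsto_tsum_of_dominated_convergence (hD.mul_left (4 * C)) (fun m => ?_) ?_
    · rw [← tendsto_add_atTop_iff_nat m]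
      have h1 : Tendsto (fun n : ℕ => (1 + (m : ℝ) / n) ^ 2 * ∑ i ∈ Finset.range (m + 1),
          (n : ℝ) ^ 3 * α n (k (n + m) - i) * β m i) atTop
          (𝓝 ((1 + 0) ^ 2 * ∑ i ∈ Finset.range (m + 1), γ x * β m i)) := by
        refine (((tendsto_const_div_atTop_nhds_zero_nat (m : ℝ)).const_add 1).pow 2).mul
          (tendsto_finsetSum _ fun i _ => ?_)
        exact (hlim _ x (tendsto_centered_shift hμ hk m i)).mul_const _
      have h2 : (1 + 0) ^ 2 * ∑ i ∈ Finset.range (m + 1), γ x * β m i =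
          (∑ i ∈ Finset.range (m + 1), β m i) * γ x := by
        rw [← Finset.mul_sum]
        ring
      rw [h2] at h1
      refine h1.congr' ?_
      filter_upwards [eventually_gt_atTop 0, eventually_ge_atTop m,
        ((tendsto_atTop_of_centered hμ hk).comp (tendsto_add_atTop_nat m)).eventually_ge_atTop m]
        with n hn hnm hkm
      have hn' : (0 : ℝ) < n := by exact_mod_cast hn
      simp only [Function.comp_apply] at hkm
      simp only [hF, if_pos (show m < (n + m) / 2 + 1 by omega), Nat.add_sub_cancel]
      have h3 : ∑ i ∈ Finset.range (k (n + m) + 1), α n (k (n + m) - i) * β m i =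
          ∑ i ∈ Finset.range (m + 1), α n (k (n + m) - i) * β m i := by
        symm
        refine Finset.sum_subset (Finset.range_subset_range.2 (by omega)) fun i _ hi => ?_
        rw [Finset.mem_range] at hi
        rw [hβs m i (by omega), mul_zero]
      rw [h3]
      simp_rw [mul_assoc, ← Finset.mul_sum]
      push_cast
      field_simp
    · filter_upwards [eventually_ge_atTop 1] with n hn m
      have hn' : (0 : ℝ) < n := by exact_mod_cast hn
      have hDm : 0 ≤ ∑ i ∈ Finset.range (m + 1), β m i := Finset.sum_nonneg fun i _ => hβ0 m i
      simp only [hF]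
      split_ifs with h
      · rw [Real.norm_of_nonneg]
        · have h1 := mul_conv_le hβ0 hα hC hβs hn h (k n)
          calc _ ≤ (n : ℝ) ^ 2 * (4 * C / (n : ℝ) ^ 2 * ∑ i ∈ Finset.range (m + 1), β m i) := by
                gcongr
            _ = _ := by field_simp
        · refine mul_nonneg (by positivity) (mul_nonneg (Nat.cast_nonneg _) ?_)
          exact Finset.sum_nonneg fun i _ => mul_nonneg (hα0 _ _) (hβ0 _ _)
      · rw [norm_zero]
        positivity
  rw [tsum_mul_right] at hmain
  have hsum := hsmall.add hmain
  rw [zero_add] at hsum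
  refine hsum.congr fun n => ?_
  have h1 : ∑' m, F n m = (n : ℝ) ^ 2 * ∑ m ∈ Finset.range (n / 2 + 1), (n - m : ℕ) *
      ∑ i ∈ Finset.range (k n + 1), α (n - m) (k n - i) * β m i := by
    rw [tsum_eq_sum (s := Finset.range (n / 2 + 1)), Finset.mul_sum]
    · refine Finset.sum_congr rfl fun m hm => ?_
      simp only [hF, if_pos (Finset.mem_range.1 hm)]
    · intro m hm
      rw [Finset.mem_range] at hm
      simp only [hF, if_neg hm]
  rw [h1, ← mul_add, ← sum_Ico_conv_eq, ← hrec]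
  ring

end

lemma floor_centered_close {μ y : ℝ} {n : ℕ} (hn : 0 < n) (h : 0 ≤ μ * n + y * √n) :
    |((⌊μ * n + y * √n⌋₊ : ℝ) - μ * n) / √n - y| ≤ 1 / √n := by
  have h0 : 0 < √(n : ℝ) := Real.sqrt_pos.2 (by exact_mod_cast hn)
  have h1 := Nat.floor_le h
  have h2 := Nat.lt_floor_add_one (μ * n + y * √n)
  have h3 : ((⌊μ * n + y * √n⌋₊ : ℝ) - μ * n) / √n - y =
      (⌊μ * n + y * √n⌋₊ - (μ * n + y * √n)) / √n := by
    field_simp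
    ring
  rw [h3, abs_div, abs_of_pos h0]
  gcongr
  rw [abs_le]
  constructor <;> linarith

lemma eventually_nonneg_affine_sqrt {μ : ℝ} (hμ : 0 < μ) (y : ℝ) :
    ∀ᶠ n : ℕ in atTop, 0 ≤ μ * n + y * √n := by
  have h1 : Tendsto (fun n : ℕ => √(n : ℝ)) atTop atTop :=
    Real.tendsto_sqrt_atTop.comp tendsto_natCast_atTop_atTop
  filter_upwards [h1.eventually_ge_atTop (-y / μ)] with n hn
  rw [div_le_iff₀ hμ] at hn
  have h2 : μ * n + y * √n = √n * (√n * μ + y) := by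
    nth_rewrite 1 [← Real.mul_self_sqrt (Nat.cast_nonneg (α := ℝ) n)]
    ring
  rw [h2]
  exact mul_nonneg (Real.sqrt_nonneg _) (by linarith)

lemma tendsto_floor_centered {μ : ℝ} (hμ : 0 < μ) (y : ℝ) :
    Tendsto (fun n : ℕ => ((⌊μ * n + y * √n⌋₊ : ℝ) - μ * n) / √n) atTop (𝓝 y) := by
  rw [tendsto_iff_norm_sub_tendsto_zero]
  refine squeeze_zero' (Eventually.of_forall fun n => norm_nonneg _) ?_ (tendsto_div_sqrt_atTop 1)
  filter_upwards [eventually_gt_atTop 0, eventually_nonneg_affine_sqrt hμ y] with n hn h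
  exact floor_centered_close hn h

lemma one_add_sq_mul_exp_le {c u y : ℝ} (hc : 0 < c) (h : |u - y| ≤ 1) :
    (1 + u ^ 2) * Real.exp (-c * u ^ 2) ≤
      (1 + 2 / c) * Real.exp (c / 2) * Real.exp (-(c / 4) * y ^ 2) := by
  have h1 : 1 + u ^ 2 ≤ (1 + 2 / c) * Real.exp (c / 2 * u ^ 2) := by
    have h2 := Real.add_one_le_exp (c / 2 * u ^ 2)
    calc 1 + u ^ 2 ≤ (1 + 2 / c) * (c / 2 * u ^ 2 + 1) := by
          have : (1 + 2 / c) * (c / 2 * u ^ 2 + 1) = 1 + u ^ 2 + (c / 2 * u ^ 2 + 2 / c) := by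
            field_simp
            ring
          rw [this]
          have : 0 ≤ c / 2 * u ^ 2 + 2 / c := by positivity
          linarith
      _ ≤ _ := by gcongr
  calc _ ≤ (1 + 2 / c) * Real.exp (c / 2 * u ^ 2) * Real.exp (-c * u ^ 2) := by gcongr
    _ = (1 + 2 / c) * Real.exp (-(c / 2) * u ^ 2) := by
        rw [mul_assoc, ← Real.exp_add]
        ring_nf
    _ ≤ (1 + 2 / c) * Real.exp (c / 2 + -(c / 4) * y ^ 2) := by
        gcongr
        have h3 : (u - y) ^ 2 ≤ 1 := by
          rw [← sq_abs]
          exact pow_le_one₀ (abs_nonneg _) h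
        nlinarith [sq_nonneg (2 * u - y), mul_le_mul_of_nonneg_left h3 hc.le]
    _ = _ := by rw [Real.exp_add, mul_assoc]

lemma sum_indicator_eq {μ : ℝ} {n : ℕ} (hn : 0 < n) (f : ℕ → ℝ) (hf : ∀ k, n < k → f k = 0)
    (y : ℝ) :
    ∑ k ∈ Finset.range (n + 1),
      (Set.Ico ((k - μ * n) / √n) ((k + 1 - μ * n) / √n)).indicator (fun _ => f k) y =
    if 0 ≤ μ * n + y * √n then f ⌊μ * n + y * √n⌋₊ else 0 := by
  have h0 : 0 < √(n : ℝ) := Real.sqrt_pos.2 (by exact_mod_cast hn)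
  have hmem : ∀ k : ℕ, y ∈ Set.Ico (((k : ℝ) - μ * n) / √n) ((k + 1 - μ * n) / √n) ↔
      (k : ℝ) ≤ μ * n + y * √n ∧ μ * n + y * √n < k + 1 := by
    intro k
    rw [Set.mem_Ico, div_le_iff₀ h0, lt_div_iff₀ h0]
    constructor <;> rintro ⟨h1, h2⟩ <;> constructor <;> linarith
  split_ifs with h
  · set K := ⌊μ * n + y * √n⌋₊ with hK
    have h1 : ∀ k : ℕ, y ∈ Set.Ico (((k : ℝ) - μ * n) / √n) ((k + 1 - μ * n) / √n) ↔ K = k := by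
      intro k
      rw [hmem, hK, Nat.floor_eq_iff h]
    simp_rw [Set.indicator_apply, h1]
    rw [Finset.sum_ite_eq]
    split_ifs with h2
    · rfl
    · rw [Finset.mem_range] at h2
      rw [hf _ (by omega)]
  · refine Finset.sum_eq_zero fun k _ => ?_
    rw [Set.indicator_of_notMem]
    rw [hmem]
    rintro ⟨h1, -⟩
    exact h ((Nat.cast_nonneg k).trans h1)

/-- Summing a local limit theorem with Gaussian tails against test functions. -/
lemma tendsto_sum_of_local_limit {β : ℕ → ℕ → ℝ} {K c μ : ℝ} {g : ℝ → ℝ} {φ : ℕ → ℝ → ℝ}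
    {ψ : ℝ → ℝ} (hβ0 : ∀ n k, 0 ≤ β n k) (hβs : ∀ n k, n < k → β n k = 0)
    (hK : 0 ≤ K) (hc : 0 < c) (hμ : 0 < μ)
    (hβ : ∀ n k, 1 ≤ n → β n k ≤ K / (n : ℝ) ^ 3 * Real.exp (-c * ((k - μ * n) ^ 2 / n)))
    (hlim : ∀ (k : ℕ → ℕ) (x : ℝ), Tendsto (fun n : ℕ => ((k n : ℝ) - μ * n) / √n) atTop (𝓝 x) →
      Tendsto (fun n : ℕ => (n : ℝ) ^ 3 * β n (k n)) atTop (𝓝 (g x)))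
    (hφ : ∀ n y, |φ n y| ≤ 1 + y ^ 2)
    (hψ : ∀ᵐ y, ∀ u : ℕ → ℝ, Tendsto u atTop (𝓝 y) →
      Tendsto (fun n => φ n (u n)) atTop (𝓝 (ψ y))) :
    Tendsto (fun n : ℕ => ∑ k ∈ Finset.range (n + 1),
      (n : ℝ) ^ 3 * β n k * φ n ((k - μ * n) / √n) * (1 / √n)) atTop (𝓝 (∫ y, g y * ψ y)) := by
  set f : ℕ → ℕ → ℝ := fun n k => (n : ℝ) ^ 3 * β n k * φ n ((k - μ * n) / √n) with hf
  set h : ℕ → ℝ → ℝ := fun n y => ∑ k ∈ Finset.range (n + 1),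
    (Set.Ico ((k - μ * n) / √n) ((k + 1 - μ * n) / √n)).indicator (fun _ => f n k) y with hh
  have hint1 : ∀ n k : ℕ, Integrable
      ((Set.Ico (((k : ℝ) - μ * n) / √n) ((k + 1 - μ * n) / √n)).indicator fun _ => f n k) := by
    intro n k
    rw [integrable_indicator_iff measurableSet_Ico]
    exact integrableOn_const (by simp)
  have hint : ∀ n, Integrable (h n) := fun n => integrable_finsetSum _ fun k _ => hint1 n k
  have hval : ∀ n, ∫ y, h n y = ∑ k ∈ Finset.range (n + 1), f n k * (1 / √n) := by
    intro n
    rw [hh, integral_finsetSum _ fun k _ => hint1 n k]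
    refine Finset.sum_congr rfl fun k _ => ?_
    rw [integral_indicator_const _ measurableSet_Ico, Real.volume_real_Ico_of_le
      (by gcongr; linarith), smul_eq_mul, mul_comm, ← sub_div]
    congr 2
    ring
  have hpt : ∀ n y, 0 < n → h n y =
      if 0 ≤ μ * n + y * √n then f n ⌊μ * n + y * √n⌋₊ else 0 := by
    intro n y hn
    exact sum_indicator_eq hn (f n) (fun k hk => by simp [hf, hβs n k hk]) y
  have hmain : Tendsto (fun n => ∫ y, h n y) atTop (𝓝 (∫ y, g y * ψ y)) := by
    refine tendsto_integral_filter_of_dominated_convergence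
      (fun y => K * ((1 + 2 / c) * Real.exp (c / 2) * Real.exp (-(c / 4) * y ^ 2)))
      (Eventually.of_forall fun n => (hint n).aestronglyMeasurable) ?_ ?_ ?_
    · filter_upwards [eventually_gt_atTop 0] with n hn
      refine Eventually.of_forall fun y => ?_
      rw [hpt n y hn]
      have hn' : (0 : ℝ) < n := by exact_mod_cast hn
      have h0 : 0 < √(n : ℝ) := Real.sqrt_pos.2 hn'
      split_ifs with hy
      · have h1 := floor_centered_close hn hy
        set k := ⌊μ * n + y * √n⌋₊
        have h2 : 1 / √(n : ℝ) ≤ 1 := by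
          rw [div_le_one h0, Real.one_le_sqrt]
          exact_mod_cast hn
        have h3 := one_add_sq_mul_exp_le hc (h1.trans h2)
        set u := ((k : ℝ) - μ * n) / √n with hu
        have h4 : u ^ 2 = ((k : ℝ) - μ * n) ^ 2 / n := by
          rw [hu, div_pow, Real.sq_sqrt hn'.le]
        have h5 := hβ n k hn
        rw [← h4, div_mul_eq_mul_div, le_div_iff₀ (by positivity), mul_comm] at h5
        simp only [hf, norm_mul, Real.norm_eq_abs]
        rw [← abs_mul, abs_of_nonneg (mul_nonneg (by positivity) (hβ0 n k))]
        calc (n : ℝ) ^ 3 * β n k * |φ n u| ≤ K * Real.exp (-c * u ^ 2) * (1 + u ^ 2) :=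
              mul_le_mul h5 (hφ n u) (abs_nonneg _) (by positivity)
          _ = K * ((1 + u ^ 2) * Real.exp (-c * u ^ 2)) := by ring
          _ ≤ _ := by gcongr
      · rw [norm_zero]
        positivity
    · exact ((integrable_exp_neg_mul_sq (by positivity)).const_mul _).const_mul _
    · filter_upwards [hψ] with y hy
      have h1 := tendsto_floor_centered hμ y
      refine ((hlim _ _ h1).mul (hy _ h1)).congr' ?_
      filter_upwards [eventually_gt_atTop 0, eventually_nonneg_affine_sqrt hμ y] with n hn hny
      rw [hpt n y hn, if_pos hny]
  refine hmain.congr fun n => ?_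
  rw [hval]

open ProbabilityTheory in
lemma integral_gaussianPDFReal_mul_id {v : NNReal} (hv : v ≠ 0) :
    ∫ y, gaussianPDFReal 0 v y * y = 0 := by
  have h := integral_gaussianReal_eq_integral_smul (μ := 0) (f := fun y : ℝ => y) hv
  rw [integral_id_gaussianReal] at h
  simpa using h.symm

open ProbabilityTheory in
lemma integral_gaussianPDFReal_mul_sq {v : NNReal} (hv : v ≠ 0) :
    ∫ y, gaussianPDFReal 0 v y * y ^ 2 = v := by
  have h := integral_gaussianReal_eq_integral_smul (μ := 0) (f := fun y : ℝ => y ^ 2) hv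
  have h1 := variance_of_integral_eq_zero (μ := gaussianReal 0 v) (X := fun x => x)
    measurable_id.aemeasurable integral_id_gaussianReal
  rw [variance_fun_id_gaussianReal] at h1
  rw [h1]
  simpa using h.symm

open ProbabilityTheory in
lemma setIntegral_gaussianPDFReal {v : NNReal} (hv : v ≠ 0) (x : ℝ) :
    ∫ y in Set.Iic (x * √v), gaussianPDFReal 0 v y =
      (√(2 * Real.pi))⁻¹ * ∫ t in Set.Iic x, Real.exp (-(t ^ 2) / 2) := by
  have hv' : 0 < (v : ℝ) := by positivity
  have hs : 0 < √(v : ℝ) := Real.sqrt_pos.2 hv'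
  have h := Measure.integral_comp_mul_right ((Set.Iic (x * √v)).indicator (gaussianPDFReal 0 v)) √v
  have hind : ∀ t, (Set.Iic (x * √v)).indicator (gaussianPDFReal 0 v) (t * √v) =
      (Set.Iic x).indicator (fun t => gaussianPDFReal 0 v (t * √v)) t := by
    intro t
    simp only [Set.indicator_apply, Set.mem_Iic, mul_le_mul_iff_left₀ hs]
  simp only [hind] at h
  rw [integral_indicator measurableSet_Iic, integral_indicator measurableSet_Iic,
    abs_of_pos (inv_pos.2 hs)] at h
  rw [← integral_const_mul]
  have h2 : ∫ y in Set.Iic (x * √v), gaussianPDFReal 0 v y =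
      √v * ∫ t in Set.Iic x, gaussianPDFReal 0 v (t * √v) := by
    rw [h, smul_eq_mul]
    field_simp
  rw [h2, ← integral_const_mul]
  congr 1 with t
  rw [gaussianPDFReal, Real.sqrt_mul (by positivity), sub_zero, mul_pow, Real.sq_sqrt hv'.le]
  field_simp

section
open ProbabilityTheory

/-- A local limit theorem with Gaussian tails implies the central limit theorem. -/
lemma tendsto_cdf_of_local_limit {β : ℕ → ℕ → ℝ} {K c μ Z : ℝ} {v : NNReal}
    (hβ0 : ∀ n k, 0 ≤ β n k) (hβs : ∀ n k, n < k → β n k = 0)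
    (hK : 0 ≤ K) (hc : 0 < c) (hμ : 0 < μ) (hZ : 0 < Z) (hv : v ≠ 0)
    (hβ : ∀ n k, 1 ≤ n → β n k ≤ K / (n : ℝ) ^ 3 * Real.exp (-c * ((k - μ * n) ^ 2 / n)))
    (hlim : ∀ (k : ℕ → ℕ) (x : ℝ), Tendsto (fun n : ℕ => ((k n : ℝ) - μ * n) / √n) atTop (𝓝 x) →
      Tendsto (fun n : ℕ => (n : ℝ) ^ 3 * β n (k n)) atTop (𝓝 (Z * gaussianPDFReal 0 v x)))
    {w E V : ℕ → ℝ} (hw : ∀ n, w n = ∑ k ∈ Finset.range (n + 1), β n k)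
    (hE : ∀ n, E n = (∑ k ∈ Finset.range (n + 1), k * β n k) / w n)
    (hV : ∀ n, V n = (∑ k ∈ Finset.range (n + 1), (k : ℝ) ^ 2 * β n k) / w n - E n ^ 2) (x : ℝ) :
    Tendsto (fun n : ℕ =>
      (∑ k ∈ Finset.range (n + 1), (if (k : ℝ) ≤ E n + x * √(V n) then 1 else 0) * β n k) / w n)
      atTop (𝓝 ((√(2 * Real.pi))⁻¹ * ∫ t in Set.Iic x, Real.exp (-(t ^ 2) / 2))) := by
  have key := fun φ ψ h1 h2 => tendsto_sum_of_local_limit (φ := φ) (ψ := ψ) hβ0 hβs hK hc hμ hβ hlim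
    h1 h2
  have hfac : ∀ (φ : ℕ → ℝ → ℝ) (n : ℕ), ∑ k ∈ Finset.range (n + 1), (n : ℝ) ^ 3 * β n k *
      φ n ((k - μ * n) / √n) * (1 / √n) = (n : ℝ) ^ 3 / √n *
      ∑ k ∈ Finset.range (n + 1), φ n ((k - μ * n) / √n) * β n k := by
    intro φ n
    rw [Finset.mul_sum]
    exact Finset.sum_congr rfl fun k _ => by ring
  simp only [hfac] at key
  have k0 := key (fun _ _ => 1) (fun _ => 1) (fun n y => by simp [sq_nonneg])
    (Eventually.of_forall fun y u _ => tendsto_const_nhds)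
  have k1 := key (fun _ y => y) (fun y => y)
    (fun n y => by rw [abs_le]; constructor <;> nlinarith [sq_nonneg (y + 1), sq_nonneg (y - 1)])
    (Eventually.of_forall fun y u hu => hu)
  have k2 := key (fun _ y => y ^ 2) (fun y => y ^ 2)
    (fun n y => by rw [abs_of_nonneg (sq_nonneg y)]; linarith)
    (Eventually.of_forall fun y u hu => hu.pow 2)
  simp only [one_mul, mul_one, ← hw, mul_assoc, integral_const_mul,
    integral_gaussianPDFReal_eq_one 0 hv, integral_gaussianPDFReal_mul_id hv,
    integral_gaussianPDFReal_mul_sq hv] at k0 k1 k2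
  have hpos : ∀ᶠ n : ℕ in atTop, 0 < w n ∧ 0 < n := by
    filter_upwards [k0.eventually (lt_mem_nhds hZ), eventually_gt_atTop 0] with n hn hn0
    refine ⟨pos_of_mul_pos_right hn (by positivity), hn0⟩
  have e1 : Tendsto (fun n : ℕ => (E n - μ * n) / √n) atTop (𝓝 0) := by
    have := k1.div k0 hZ.ne'
    rw [mul_zero, zero_div] at this
    refine this.congr' ?_
    filter_upwards [hpos] with n ⟨hn, hn0⟩
    have h0 : 0 < √(n : ℝ) := Real.sqrt_pos.2 (by exact_mod_cast hn0)
    have hn0' : (0 : ℝ) < n := by exact_mod_cast hn0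
    have h1 : ∑ k ∈ Finset.range (n + 1), ((k : ℝ) - μ * n) / √n * β n k =
        (E n * w n - μ * n * w n) / √n := by
      rw [hE, div_mul_cancel₀ _ hn.ne', hw, Finset.mul_sum, ← Finset.sum_sub_distrib,
        Finset.sum_div]
      exact Finset.sum_congr rfl fun k _ => by ring
    simp only [Pi.div_apply]
    rw [h1]
    field_simp
  have e2 : Tendsto (fun n : ℕ => V n / n) atTop (𝓝 v) := by
    have := (k2.div k0 hZ.ne').sub (e1.pow 2)
    rw [mul_div_cancel_left₀ _ hZ.ne', zero_pow two_ne_zero, sub_zero] at this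
    refine this.congr' ?_
    filter_upwards [hpos] with n ⟨hn, hn0⟩
    have h0 : 0 < √(n : ℝ) := Real.sqrt_pos.2 (by exact_mod_cast hn0)
    have hn0' : (0 : ℝ) < n := by exact_mod_cast hn0
    have h3 : ∑ k ∈ Finset.range (n + 1), (k : ℝ) ^ 2 * β n k = (V n + E n ^ 2) * w n := by
      rw [hV]
      field_simp
      ring
    have h4 : ∑ k ∈ Finset.range (n + 1), (k : ℝ) * β n k = E n * w n := by
      rw [hE, div_mul_cancel₀ _ hn.ne']
    have h1 : ∑ k ∈ Finset.range (n + 1), (((k : ℝ) - μ * n) / √n) ^ 2 * β n k =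
        ((V n + E n ^ 2) * w n - 2 * (μ * n) * (E n * w n) + (μ * n) ^ 2 * w n) / n := by
      rw [← h3, ← h4, hw, Finset.mul_sum, Finset.mul_sum, ← Finset.sum_sub_distrib,
        ← Finset.sum_add_distrib, Finset.sum_div]
      refine Finset.sum_congr rfl fun k _ => ?_
      rw [div_pow, Real.sq_sqrt hn0'.le]
      ring
    simp only [Pi.div_apply]
    rw [h1, div_pow, Real.sq_sqrt hn0'.le]
    field_simp
    ring
  have e3 : Tendsto (fun n : ℕ => (E n + x * √(V n) - μ * n) / √n) atTop (𝓝 (x * √v)) := by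
    have := e1.add (e2.sqrt.const_mul x)
    rw [zero_add] at this
    refine this.congr fun n => ?_
    rw [Real.sqrt_div' _ (Nat.cast_nonneg n)]
    ring
  have k3 := key (fun n y => if y ≤ (E n + x * √(V n) - μ * n) / √n then 1 else 0)
    ((Set.Iic (x * √v)).indicator fun _ => 1)
    (fun n y => by
      split_ifs
      · simp [sq_nonneg]
      · rw [abs_zero]
        positivity) (by
      filter_upwards [Measure.ae_ne volume (x * √v)] with y hy u hu
      rcases lt_or_gt_of_ne hy with h | h
      · rw [Set.indicator_of_mem (Set.mem_Iic.2 h.le)]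
        refine tendsto_const_nhds.congr' ?_
        filter_upwards [hu.eventually_lt e3 h] with n hn
        rw [if_pos hn.le]
      · rw [Set.indicator_of_notMem (by simpa using h)]
        refine tendsto_const_nhds.congr' ?_
        filter_upwards [e3.eventually_lt hu h] with n hn
        rw [if_neg hn.not_ge])
  have hint : ∫ y, Z * gaussianPDFReal 0 v y * (Set.Iic (x * √v)).indicator (fun _ => 1) y =
      Z * ((√(2 * Real.pi))⁻¹ * ∫ t in Set.Iic x, Real.exp (-(t ^ 2) / 2)) := by
    rw [← setIntegral_gaussianPDFReal hv, ← integral_const_mul,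
      ← integral_indicator measurableSet_Iic]
    congr 1 with y
    by_cases hy : y ∈ Set.Iic (x * √v)
    · simp [Set.indicator_of_mem hy]
    · simp [Set.indicator_of_notMem hy]
  rw [hint] at k3
  have k4 := k3.div k0 hZ.ne'
  rw [mul_div_cancel_left₀ _ hZ.ne'] at k4
  refine k4.congr' ?_
  filter_upwards [hpos] with n ⟨hn, hn0⟩
  have h0 : 0 < √(n : ℝ) := Real.sqrt_pos.2 (by exact_mod_cast hn0)
  have hn0' : (0 : ℝ) < n := by exact_mod_cast hn0
  simp only [Pi.div_apply]
  rw [mul_div_mul_left _ _ (by positivity)]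
  congr 1
  refine Finset.sum_congr rfl fun k _ => ?_
  simp only [div_le_div_iff_of_pos_right h0, sub_le_sub_iff_right]

end

open ProbabilityTheory in
/-- The central limit theorem for the solution of the convolution equation, given the local limit
theorem with Gaussian tails for the input. -/
lemma tendsto_cdf_of_conv {α β : ℕ → ℕ → ℝ} {C c μ G : ℝ} {v : NNReal}
    (hα0 : ∀ n k, 0 ≤ α n k) (hβ0 : ∀ n k, 0 ≤ β n k) (hβ00 : 0 < β 0 0)
    (hαs : ∀ n k, n < k → α n k = 0) (hβs : ∀ n k, n < k → β n k = 0)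
    (hC : 0 ≤ C) (hc : 0 < c) (hμ : 0 < μ) (hG : 0 < G) (hv : v ≠ 0)
    (hα : ∀ n k, 1 ≤ n → α n k ≤ C / (n : ℝ) ^ 3 * Real.exp (-c * ((k - μ * n) ^ 2 / n)))
    (hlim : ∀ (k : ℕ → ℕ) (x : ℝ), Tendsto (fun n : ℕ => ((k n : ℝ) - μ * n) / √n) atTop (𝓝 x) →
      Tendsto (fun n : ℕ => (n : ℝ) ^ 3 * α n (k n)) atTop (𝓝 (G * gaussianPDFReal 0 v x)))
    (hrec : ∀ n k : ℕ, n * β n k = ∑ s ∈ Finset.range (n + 1), s *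
      ∑ i ∈ Finset.range (k + 1), α s i * β (n - s) (k - i))
    {w E V : ℕ → ℝ} (hw : ∀ n, w n = ∑ k ∈ Finset.range (n + 1), β n k)
    (hE : ∀ n, E n = (∑ k ∈ Finset.range (n + 1), k * β n k) / w n)
    (hV : ∀ n, V n = (∑ k ∈ Finset.range (n + 1), (k : ℝ) ^ 2 * β n k) / w n - E n ^ 2) (x : ℝ) :
    Tendsto (fun n : ℕ =>
      (∑ k ∈ Finset.range (n + 1), (if (k : ℝ) ≤ E n + x * √(V n) then 1 else 0) * β n k) / w n)
      atTop (𝓝 ((√(2 * Real.pi))⁻¹ * ∫ t in Set.Iic x, Real.exp (-(t ^ 2) / 2))) := by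
  have hle : ∀ {A c : ℝ} {n k : ℕ}, 0 ≤ A → 0 < c →
      A / (n : ℝ) ^ 3 * Real.exp (-c * ((k - μ * n) ^ 2 / n)) ≤ A / (n : ℝ) ^ 3 := by
    intro A c n k hA hc
    refine mul_le_of_le_one_right (by positivity) (Real.exp_le_one_iff.2 ?_)
    rw [neg_mul]
    exact neg_nonpos.2 (by positivity)
  obtain ⟨K, hK, hβ⟩ := exists_gaussian_bound hα0 hβ0 hC hc hαs hβs hα hrec
  have hα3 : ∀ n k, 1 ≤ n → α n k ≤ C / (n : ℝ) ^ 3 := fun n k hn => (hα n k hn).trans (hle hC hc)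
  have hβ3 : ∀ n k, 1 ≤ n → β n k ≤ K / (n : ℝ) ^ 3 :=
    fun n k hn => (hβ n k hn).trans (hle hK (half_pos hc))
  have hsum := summable_row_sums hα0 hβ0 hC hα3 hαs hβs fun n k => (hrec n k).le
  have hB : 0 < ∑' m, ∑ i ∈ Finset.range (m + 1), β m i :=
    hsum.tsum_pos (fun m => Finset.sum_nonneg fun i _ => hβ0 m i) 0 (by simpa using hβ00)
  refine tendsto_cdf_of_local_limit hβ0 hβs hK (half_pos hc) hμ (mul_pos hB hG) hv hβ ?_ hw hE hV x
  intro k y hk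
  rw [mul_assoc]
  exact local_limit hα0 hβ0 hC hK hαs hβs hα3 hβ3 hrec hμ hlim hk

/-- The exponential growth rate of the number of pairs of a tree on `n` vertices and a maximal
matching with `κ * n` edges, relative to `n!`. -/
noncomputable def matchingEntropy (κ : ℝ) : ℝ :=
  (1 - 2 * κ) * Real.log 2 + (1 - 3 * κ) * Real.log κ - (1 - 2 * κ) * Real.log (1 - 2 * κ) + 1 - κ

/-- The derivative of `matchingEntropy`. -/
noncomputable def matchingEntropyDeriv (κ : ℝ) : ℝ :=
  -2 * Real.log 2 - 3 * Real.log κ + κ⁻¹ - 2 + 2 * Real.log (1 - 2 * κ)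

lemma hasDerivAt_matchingEntropy {κ : ℝ} (h0 : 0 < κ) (h1 : κ < 1 / 2) :
    HasDerivAt matchingEntropy (matchingEntropyDeriv κ) κ := by
  have h2 : 1 - 2 * κ ≠ 0 := by linarith
  have d1 : HasDerivAt (fun κ : ℝ => 1 - 2 * κ) (-2) κ := by
    simpa using ((hasDerivAt_id κ).const_mul 2).const_sub 1
  have d2 : HasDerivAt (fun κ : ℝ => 1 - 3 * κ) (-3) κ := by
    simpa using ((hasDerivAt_id κ).const_mul 3).const_sub 1
  have := ((((d1.mul_const (Real.log 2)).add (d2.mul (Real.hasDerivAt_log h0.ne'))).sub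
    (d1.mul (d1.log h2))).add_const 1).sub (hasDerivAt_id κ)
  refine this.congr_deriv ?_
  rw [matchingEntropyDeriv]
  field_simp
  ring

lemma hasDerivAt_matchingEntropyDeriv {κ : ℝ} (h0 : 0 < κ) (h1 : κ < 1 / 2) :
    HasDerivAt matchingEntropyDeriv (-3 / κ - (κ ^ 2)⁻¹ - 4 / (1 - 2 * κ)) κ := by
  have h2 : 1 - 2 * κ ≠ 0 := by linarith
  have d1 : HasDerivAt (fun κ : ℝ => 1 - 2 * κ) (-2) κ := by
    simpa using ((hasDerivAt_id κ).const_mul 2).const_sub 1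
  have := (((((Real.hasDerivAt_log h0.ne').const_mul 3).const_sub (-2 * Real.log 2)).add
    (hasDerivAt_inv h0.ne')).sub_const 2).add ((d1.log h2).const_mul 2)
  refine this.congr_deriv ?_
  field_simp
  ring

lemma deriv_matchingEntropyDeriv_le {κ : ℝ} (h0 : 0 < κ) (h1 : κ < 1 / 2) :
    -3 / κ - (κ ^ 2)⁻¹ - 4 / (1 - 2 * κ) ≤ -10 := by
  have h2 : 6 ≤ 3 / κ := by
    rw [le_div_iff₀ h0]
    linarith
  have h3 : 4 ≤ 4 / (1 - 2 * κ) := by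
    rw [le_div_iff₀ (by linarith)]
    linarith
  have h4 : 0 < (κ ^ 2)⁻¹ := by positivity
  rw [neg_div]
  linarith

lemma continuousOn_matchingEntropy : ContinuousOn matchingEntropy (Set.Ioi 0) := by
  have h1 : Continuous fun κ : ℝ => (1 - 2 * κ) * Real.log (1 - 2 * κ) :=
    Real.continuous_mul_log.comp (f := fun κ : ℝ => 1 - 2 * κ) (by fun_prop)
  have h2 : ContinuousOn Real.log (Set.Ioi 0) :=
    Real.continuousOn_log.mono fun x hx => (Set.mem_Ioi.1 hx).ne'
  have h3 : Continuous fun κ : ℝ => (1 - 2 * κ) * Real.log 2 := by fun_prop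
  have h4 : Continuous fun κ : ℝ => 1 - 3 * κ := by fun_prop
  exact (((h3.continuousOn.add (h4.continuousOn.mul h2)).sub h1.continuousOn).add
    continuousOn_const).sub continuousOn_id

lemma exists_matchingEntropyDeriv_eq_zero :
    ∃ μ : ℝ, 1 / 4 < μ ∧ μ < 7 / 16 ∧ matchingEntropyDeriv μ = 0 := by
  have hcont : ContinuousOn matchingEntropyDeriv (Set.Icc (1 / 4) (7 / 16)) := fun κ hκ =>
    (hasDerivAt_matchingEntropyDeriv (by linarith [hκ.1]) (by linarith [hκ.2])).continuousAt
      |>.continuousWithinAt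
  have h4 : Real.log 4 = 2 * Real.log 2 := by
    rw [show (4 : ℝ) = 2 ^ 2 by norm_num, Real.log_pow]
    norm_num
  have h2 : 0 < Real.log 2 := Real.log_pos (by norm_num)
  have hl : 0 < matchingEntropyDeriv (1 / 4) := by
    rw [matchingEntropyDeriv, show (1 : ℝ) - 2 * (1 / 4) = 2⁻¹ by norm_num, one_div, inv_inv,
      Real.log_inv, Real.log_inv, h4]
    linarith
  have hr : matchingEntropyDeriv (7 / 16) < 0 := by
    have h16 : Real.log 16 = 4 * Real.log 2 := by
      rw [show (16 : ℝ) = 2 ^ 4 by norm_num, Real.log_pow]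
      norm_num
    have h8 : Real.log 8 = 3 * Real.log 2 := by
      rw [show (8 : ℝ) = 2 ^ 3 by norm_num, Real.log_pow]
      norm_num
    have h343 : Real.log (16 / 343) = 4 * Real.log 2 - 3 * Real.log 7 := by
      rw [Real.log_div (by norm_num) (by norm_num), h16, show (343 : ℝ) = 7 ^ 3 by norm_num,
        Real.log_pow]
      norm_num
    have := Real.log_le_sub_one_of_pos (show (0 : ℝ) < 16 / 343 by norm_num)
    rw [matchingEntropyDeriv, show (1 : ℝ) - 2 * (7 / 16) = 8⁻¹ by norm_num, Real.log_inv, h8,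
      Real.log_div (by norm_num) (by norm_num), h16]
    norm_num at this ⊢
    linarith
  obtain ⟨μ, hμ, h0⟩ := intermediate_value_Icc' (by norm_num) hcont ⟨hr.le, hl.le⟩
  refine ⟨μ, lt_of_le_of_ne hμ.1 ?_, lt_of_le_of_ne hμ.2 ?_, h0⟩
  · rintro rfl
    exact hl.ne' h0
  · rintro rfl
    exact hr.ne h0

lemma matchingEntropy_le {μ κ : ℝ} (hμ0 : 0 < μ) (hμ1 : μ < 1 / 2)
    (hμ : matchingEntropyDeriv μ = 0) (h0 : 0 < κ) (h1 : κ ≤ 1 / 2) :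
    matchingEntropy κ ≤ matchingEntropy μ - 5 * (κ - μ) ^ 2 := by
  have hd : ∀ κ, 0 < κ → κ < 1 / 2 → HasDerivAt (fun κ => matchingEntropy κ + 5 * (κ - μ) ^ 2)
      (matchingEntropyDeriv κ + 10 * (κ - μ)) κ := by
    intro κ h0 h1
    refine ((hasDerivAt_matchingEntropy h0 h1).add
      ((((hasDerivAt_id κ).sub_const μ).pow 2).const_mul 5)).congr_deriv ?_
    simp
    ring
  have hd2 : ∀ κ, 0 < κ → κ < 1 / 2 → HasDerivAt
      (fun κ => matchingEntropyDeriv κ + 10 * (κ - μ))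
      (-3 / κ - (κ ^ 2)⁻¹ - 4 / (1 - 2 * κ) + 10) κ := by
    intro κ h0 h1
    refine ((hasDerivAt_matchingEntropyDeriv h0 h1).add
      (((hasDerivAt_id κ).sub_const μ).const_mul 10)).congr_deriv ?_
    simp
  have hanti : AntitoneOn (fun κ => matchingEntropyDeriv κ + 10 * (κ - μ)) (Set.Ioo 0 (1 / 2)) := by
    refine antitoneOn_of_deriv_nonpos (convex_Ioo _ _)
      (fun x hx => (hd2 x hx.1 hx.2).continuousAt.continuousWithinAt)
      (fun x hx => ?_) fun x hx => ?_
    · rw [interior_Ioo] at hx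
      exact (hd2 x hx.1 hx.2).differentiableAt.differentiableWithinAt
    · rw [interior_Ioo] at hx
      rw [(hd2 x hx.1 hx.2).deriv]
      linarith [deriv_matchingEntropyDeriv_le hx.1 hx.2]
  have hcont : ContinuousOn (fun κ => matchingEntropy κ + 5 * (κ - μ) ^ 2) (Set.Ioi 0) :=
    continuousOn_matchingEntropy.add (by fun_prop)
  suffices matchingEntropy κ + 5 * (κ - μ) ^ 2 ≤ matchingEntropy μ + 5 * (μ - μ) ^ 2 by
    simp only [sub_self, ne_eq, OfNat.ofNat_ne_zero, not_false_eq_true, zero_pow, mul_zero,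
      add_zero] at this
    linarith
  rcases le_total κ μ with h | h
  · refine monotoneOn_of_deriv_nonneg (convex_Icc κ μ)
      (hcont.mono fun x hx => lt_of_lt_of_le h0 hx.1) (fun x hx => ?_) (fun x hx => ?_)
      ⟨le_rfl, h⟩ ⟨h, le_rfl⟩ h
    · rw [interior_Icc] at hx
      exact (hd x (h0.trans hx.1) (hx.2.trans hμ1)).differentiableAt.differentiableWithinAt
    · rw [interior_Icc] at hx
      rw [(hd x (h0.trans hx.1) (hx.2.trans hμ1)).deriv]
      have := hanti ⟨h0.trans hx.1, hx.2.trans hμ1⟩ ⟨hμ0, hμ1⟩ hx.2.le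
      simpa [hμ] using this
  · refine antitoneOn_of_deriv_nonpos (convex_Icc μ κ)
      (hcont.mono fun x hx => lt_of_lt_of_le hμ0 hx.1) (fun x hx => ?_) (fun x hx => ?_)
      ⟨le_rfl, h⟩ ⟨h, le_rfl⟩ h
    · rw [interior_Icc] at hx
      exact (hd x (hμ0.trans hx.1) (hx.2.trans_le h1)).differentiableAt.differentiableWithinAt
    · rw [interior_Icc] at hx
      rw [(hd x (hμ0.trans hx.1) (hx.2.trans_le h1)).deriv]
      have := hanti ⟨hμ0, hμ1⟩ ⟨hμ0.trans hx.1, hx.2.trans_le h1⟩ hx.1.le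
      simpa [hμ] using this

lemma isLittleO_of_deriv_eq_zero {f f' : ℝ → ℝ} {f'' μ : ℝ}
    (hf : ∀ᶠ x in 𝓝 μ, HasDerivAt f (f' x) x) (hf' : HasDerivAt f' f'' μ) (h0 : f' μ = 0) :
    (fun x => f x - f μ - f'' / 2 * (x - μ) ^ 2) =o[𝓝 μ] fun x => (x - μ) ^ 2 := by
  obtain ⟨ε, hε, hball⟩ := Metric.eventually_nhds_iff_ball.1 hf
  have hs := Metric.ball_mem_nhds μ hε
  have h1 := (convex_ball μ ε).isLittleO_pow_succ_real (x₀ := μ) (n := 1)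
    (f := fun x => f x - f'' / 2 * (x - μ) ^ 2) (f' := fun x => f' x - f'' * (x - μ))
    (Metric.mem_ball_self hε) (fun x hx => ?_) ?_
  · rw [nhdsWithin_eq_nhds.2 hs] at h1
    refine h1.congr_left fun x => ?_
    ring
  · refine HasDerivAt.hasDerivWithinAt (((hball x hx).sub
      ((((hasDerivAt_id x).sub_const μ).pow 2).const_mul (f'' / 2))).congr_deriv ?_)
    simp
    ring
  · rw [nhdsWithin_eq_nhds.2 hs]
    have := hasDerivAt_iff_isLittleO.1 hf'
    refine this.congr (fun x => ?_) fun x => ?_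
    · rw [h0, smul_eq_mul]
      ring
    · rw [pow_one]

lemma tendsto_div_of_centered {μ x : ℝ} {k : ℕ → ℕ}
    (hk : Tendsto (fun n : ℕ => ((k n : ℝ) - μ * n) / √n) atTop (𝓝 x)) :
    Tendsto (fun n : ℕ => (k n : ℝ) / n) atTop (𝓝 μ) := by
  have h1 := (hk.mul (tendsto_div_sqrt_atTop 1)).add_const μ
  rw [mul_zero, zero_add] at h1
  refine h1.congr' ?_
  filter_upwards [eventually_gt_atTop 0] with n hn
  have hn' : (0 : ℝ) < n := by exact_mod_cast hn
  have : √(n : ℝ) ≠ 0 := (Real.sqrt_pos.2 hn').ne'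
  rw [div_mul_div_comm, Real.mul_self_sqrt hn'.le]
  field_simp
  ring

lemma tendsto_mul_sub_of_deriv_eq_zero {f f' : ℝ → ℝ} {f'' μ x : ℝ}
    (hf : ∀ᶠ x in 𝓝 μ, HasDerivAt f (f' x) x) (hf' : HasDerivAt f' f'' μ) (h0 : f' μ = 0)
    {k : ℕ → ℕ} (hk : Tendsto (fun n : ℕ => ((k n : ℝ) - μ * n) / √n) atTop (𝓝 x)) :
    Tendsto (fun n : ℕ => n * (f (k n / n) - f μ)) atTop (𝓝 (f'' / 2 * x ^ 2)) := by
  have hκ := tendsto_div_of_centered hk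
  have h2 : ∀ᶠ n : ℕ in atTop, (n : ℝ) * ((k n : ℝ) / n - μ) ^ 2 =
      (((k n : ℝ) - μ * n) / √n) ^ 2 := by
    filter_upwards [eventually_gt_atTop 0] with n hn
    have hn' : (0 : ℝ) < n := by exact_mod_cast hn
    rw [div_pow, Real.sq_sqrt hn'.le]
    field_simp
  have h3 : Tendsto (fun n : ℕ => n * (f (k n / n) - f μ - f'' / 2 * ((k n : ℝ) / n - μ) ^ 2))
      atTop (𝓝 0) := by
    have h4 := (isLittleO_of_deriv_eq_zero hf hf' h0).comp_tendsto hκ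
    have h5 := (Asymptotics.isBigO_refl (fun n : ℕ => (n : ℝ)) atTop).mul_isLittleO h4
    have h6 : (fun n : ℕ => (n : ℝ) * ((k n : ℝ) / n - μ) ^ 2) =O[atTop] fun _ => (1 : ℝ) :=
      ((hk.pow 2).congr' (h2.mono fun n hn => hn.symm)).isBigO_one ℝ
    exact (Asymptotics.isLittleO_one_iff ℝ).1 (h5.trans_isBigO h6)
  have h6 := h3.add ((hk.pow 2).const_mul (f'' / 2))
  rw [zero_add] at h6
  refine h6.congr' ?_
  filter_upwards [h2] with n hn
  rw [← hn]
  ring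

/-- Stirling's approximation to `m!`, without the square root factor, over `m!`. -/
noncomputable def stirlingRatio (m : ℕ) : ℝ := (m / Real.exp 1) ^ m / m.factorial

lemma stirlingRatio_nonneg (m : ℕ) : 0 ≤ stirlingRatio m := by
  unfold stirlingRatio
  positivity

lemma stirlingRatio_le (m : ℕ) : stirlingRatio m ≤ 1 / √(m + 1) := by
  rw [stirlingRatio, div_le_div_iff₀ (by positivity) (by positivity), one_mul, mul_comm]
  rcases Nat.eq_zero_or_pos m with rfl | hm
  · simp
  · refine le_trans ?_ (Stirling.le_factorial_stirling m)
    have hm' : (1 : ℝ) ≤ m := by exact_mod_cast hm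
    gcongr
    nlinarith [Real.pi_gt_three]

lemma tendsto_sqrt_mul_stirlingRatio :
    Tendsto (fun m : ℕ => √m * stirlingRatio m) atTop (𝓝 (1 / √(2 * Real.pi))) := by
  have h := Stirling.tendsto_stirlingSeq_sqrt_pi.inv₀ (Real.sqrt_pos.2 Real.pi_pos).ne'
  have h1 : 1 / √2 * (√Real.pi)⁻¹ = 1 / √(2 * Real.pi) := by
    rw [Real.sqrt_mul two_pos.le]
    field_simp
  rw [← h1]
  refine (h.const_mul (1 / √2)).congr fun m => ?_
  rw [Stirling.stirlingSeq, stirlingRatio, inv_div, Real.sqrt_mul two_pos.le]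
  field_simp

lemma tree_term_eq {n k j : ℕ} (hk : 0 < k) (hn : 2 * k + j = n) :
    (2 * k : ℝ) ^ j * (n : ℝ) ^ k / (2 * k * n * k.factorial * j.factorial) =
      1 / (2 * k * n) * stirlingRatio k * stirlingRatio j *
        Real.exp (n * matchingEntropy (k / n)) := by
  have hn0 : 0 < n := by omega
  have hk' : (0 : ℝ) < k := by exact_mod_cast hk
  have hn' : (0 : ℝ) < n := by exact_mod_cast hn0
  have hj : (j : ℝ) = n - 2 * k := by
    rw [← hn]
    push_cast
    ring
  have hjlog : ∀ m : ℕ, (m : ℝ) ^ m = Real.exp (m * Real.log m) := by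
    intro m
    rcases Nat.eq_zero_or_pos m with rfl | hm
    · simp
    · rw [mul_comm, Real.exp_mul, Real.exp_log (by exact_mod_cast hm), Real.rpow_natCast]
  have hS : ∀ m : ℕ, stirlingRatio m = Real.exp (m * Real.log m - m) / m.factorial := by
    intro m
    rw [stirlingRatio, div_pow, hjlog, Real.exp_sub, ← Real.exp_nat_mul, mul_one]
  have h1 : (2 * k : ℝ) ^ j = Real.exp (j * (Real.log 2 + Real.log k)) := by
    rw [← Real.log_mul two_ne_zero hk'.ne', mul_comm (j : ℝ), Real.exp_mul,
      Real.exp_log (by positivity), Real.rpow_natCast]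
  have h2 : (n : ℝ) ^ k = Real.exp (k * Real.log n) := by
    rw [mul_comm, Real.exp_mul, Real.exp_log hn', Real.rpow_natCast]
  have h3 : n * matchingEntropy (k / n) = j * (Real.log 2 + Real.log k) + k * Real.log n
      - (k * Real.log k - k) - (j * Real.log j - j) := by
    have h4 : (j : ℝ) * Real.log (1 - 2 * (k / n)) = j * (Real.log j - Real.log n) := by
      rcases Nat.eq_zero_or_pos j with rfl | hj0
      · simp
      · rw [← Real.log_div (by exact_mod_cast hj0.ne') hn'.ne', hj]
        congr 2
        field_simp
    have h5 : (n : ℝ) * (1 - 2 * (k / n)) = j := by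
      rw [hj]
      field_simp
    have h6 : (n : ℝ) * (1 - 3 * (k / n)) = j - k := by
      rw [hj]
      field_simp
      ring
    have h7 : (n : ℝ) * (k / n) = k := by field_simp
    calc (n : ℝ) * matchingEntropy (k / n) = n * (1 - 2 * (k / n)) * Real.log 2 +
          n * (1 - 3 * (k / n)) * (Real.log k - Real.log n) -
          n * (1 - 2 * (k / n)) * Real.log (1 - 2 * (k / n)) + n - n * (k / n) := by
          rw [matchingEntropy, Real.log_div hk'.ne' hn'.ne']
          ring
      _ = _ := by
          rw [h5, h6, h7, h4, hj]
          ring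
  have h4 : (2 * k : ℝ) ^ j * (n : ℝ) ^ k = Real.exp (k * Real.log k - k) *
      Real.exp (j * Real.log j - j) * Real.exp (n * matchingEntropy (k / n)) := by
    rw [h1, h2, h3, ← Real.exp_add, ← Real.exp_add, ← Real.exp_add]
    ring_nf
  rw [h4, hS, hS]
  ring

lemma sq_div_le_mul_exp {n k j : ℕ} {μ : ℝ} (hμ0 : 1 / 4 < μ) (hμ1 : μ < 7 / 16) (hk : 0 < k)
    (hn : 2 * k + j = n) :
    (n : ℝ) ^ 2 / (2 * k * √(k + 1) * √(j + 1)) ≤ 2 ^ 20 * Real.exp ((k - μ * n) ^ 2 / n) := by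
  have hn0 : 0 < n := by omega
  have hk' : (1 : ℝ) ≤ k := by exact_mod_cast hk
  have hn' : (0 : ℝ) < n := by exact_mod_cast hn0
  have hj : (j : ℝ) = n - 2 * k := by
    rw [← hn]
    push_cast
    ring
  have hs1 : 1 ≤ √((k : ℝ) + 1) := Real.one_le_sqrt.2 (by linarith)
  have hs2 : 1 ≤ √((j : ℝ) + 1) := Real.one_le_sqrt.2 (by linarith [Nat.cast_nonneg (α := ℝ) j])
  by_cases hc : (n : ℝ) / 8 ≤ k ∧ (n : ℝ) / 16 ≤ j
  · have h1 : √(n / 16) * √(n / 16) ≤ √((k : ℝ) + 1) * √((j : ℝ) + 1) := by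
      gcongr
      · linarith
      · linarith
    rw [Real.mul_self_sqrt (by positivity)] at h1
    have h2 : (n : ℝ) ^ 2 / (2 * k * √(k + 1) * √(j + 1)) ≤ 64 := by
      rw [div_le_iff₀ (by positivity)]
      have := mul_le_mul hc.1 h1 (by positivity) (by positivity)
      nlinarith
    have h3 : 1 ≤ Real.exp (((k : ℝ) - μ * n) ^ 2 / n) := Real.one_le_exp (by positivity)
    linarith
  · have h1 : (n : ℝ) / 1024 ≤ (k - μ * n) ^ 2 / n := by
      rw [div_le_div_iff₀ (by norm_num) hn']
      have h2 : (n : ℝ) / 32 ≤ |k - μ * n| := by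
        rw [le_abs]
        rcases not_and_or.1 hc with h | h
        · right
          nlinarith
        · left
          nlinarith
      have := mul_self_le_mul_self (by positivity) h2
      rw [abs_mul_abs_self] at this
      nlinarith
    have h2 : (n : ℝ) ^ 2 / (2 * k * √(k + 1) * √(j + 1)) ≤ n ^ 2 / 2 := by
      gcongr
      have : (1 : ℝ) ≤ k * √(k + 1) * √(j + 1) :=
        one_le_mul_of_one_le_of_one_le (one_le_mul_of_one_le_of_one_le hk' hs1) hs2
      linarith
    have h3 := Real.quadratic_le_exp_of_nonneg (show (0 : ℝ) ≤ n / 1024 by positivity)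
    have h4 := Real.exp_le_exp.2 h1
    nlinarith

lemma tree_term_le {n k j : ℕ} {μ : ℝ} (hμ0 : 1 / 4 < μ) (hμ1 : μ < 7 / 16)
    (hμ : matchingEntropyDeriv μ = 0) (hk : 0 < k) (hn : 2 * k + j = n) :
    (2 * k : ℝ) ^ j * (n : ℝ) ^ k / (2 * k * n * k.factorial * j.factorial) *
      Real.exp (-matchingEntropy μ) ^ n ≤
      2 ^ 20 / (n : ℝ) ^ 3 * Real.exp (-4 * ((k - μ * n) ^ 2 / n)) := by
  have hn0 : 0 < n := by omega
  have hk' : (0 : ℝ) < k := by exact_mod_cast hk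
  have hn' : (0 : ℝ) < n := by exact_mod_cast hn0
  have h2k : (2 * k : ℝ) ≤ n := by exact_mod_cast (show 2 * k ≤ n by omega)
  have hent := matchingEntropy_le (by linarith) (by linarith) hμ (div_pos hk' hn')
    (show (k : ℝ) / n ≤ 1 / 2 by rw [div_le_div_iff₀ hn' two_pos]; linarith)
  have h1 : (n : ℝ) * matchingEntropy (k / n) + n * (-matchingEntropy μ) ≤
      -5 * ((k - μ * n) ^ 2 / n) := by
    have h2 : (n : ℝ) * (5 * (k / n - μ) ^ 2) = 5 * ((k - μ * n) ^ 2 / n) := by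
      field_simp
    nlinarith [mul_le_mul_of_nonneg_left hent hn'.le]
  rw [tree_term_eq hk hn, ← Real.exp_nat_mul, mul_assoc, ← Real.exp_add]
  calc _ ≤ 1 / (2 * k * n) * (1 / √(k + 1)) * (1 / √(j + 1)) *
        Real.exp (-5 * ((k - μ * n) ^ 2 / n)) := by
        have := stirlingRatio_nonneg k
        have := stirlingRatio_nonneg j
        gcongr
        · exact stirlingRatio_le k
        · exact stirlingRatio_le j
    _ = (n : ℝ) ^ 2 / (2 * k * √(k + 1) * √(j + 1)) * (1 / (n : ℝ) ^ 3) *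
        Real.exp (-5 * ((k - μ * n) ^ 2 / n)) := by
        field_simp
    _ ≤ 2 ^ 20 * Real.exp ((k - μ * n) ^ 2 / n) * (1 / (n : ℝ) ^ 3) *
        Real.exp (-5 * ((k - μ * n) ^ 2 / n)) := by
        gcongr
        exact sq_div_le_mul_exp hμ0 hμ1 hk hn
    _ = 2 ^ 20 / (n : ℝ) ^ 3 * (Real.exp ((k - μ * n) ^ 2 / n) *
        Real.exp (-5 * ((k - μ * n) ^ 2 / n))) := by ring
    _ = _ := by
        rw [← Real.exp_add]
        ring_nf

lemma tendsto_tree_term {α : ℕ → ℕ → ℝ} {μ h x : ℝ} {k : ℕ → ℕ} (hμ0 : 0 < μ) (hμ1 : μ < 1 / 2)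
    (hμ : matchingEntropyDeriv μ = 0) (hh : HasDerivAt matchingEntropyDeriv h μ)
    (hα : ∀ n k j, 0 < k → 2 * k + j = n → α n k =
      (2 * k : ℝ) ^ j * (n : ℝ) ^ k / (2 * k * n * k.factorial * j.factorial) *
        Real.exp (-matchingEntropy μ) ^ n)
    (hk : Tendsto (fun n : ℕ => ((k n : ℝ) - μ * n) / √n) atTop (𝓝 x)) :
    Tendsto (fun n : ℕ => (n : ℝ) ^ 3 * α n (k n)) atTop
      (𝓝 (1 / (2 * μ) * (1 / √μ) * (1 / √(1 - 2 * μ)) * (1 / √(2 * Real.pi)) *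
        (1 / √(2 * Real.pi)) * Real.exp (h / 2 * x ^ 2))) := by
  have hκ := tendsto_div_of_centered hk
  have hk1 := tendsto_atTop_of_centered hμ0 hk
  have hev : ∀ᶠ n : ℕ in atTop, 0 < k n ∧ 2 * k n < n := by
    filter_upwards [hk1.eventually_gt_atTop 0, hκ.eventually_lt_const hμ1,
      eventually_gt_atTop 0] with n h1 h2 h3
    refine ⟨h1, ?_⟩
    rw [div_lt_iff₀ (by exact_mod_cast h3)] at h2
    have : (2 * k n : ℝ) < n := by linarith
    exact_mod_cast this
  have hj : Tendsto (fun n : ℕ => ((n - 2 * k n : ℕ) : ℝ) / n) atTop (𝓝 (1 - 2 * μ)) := by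
    refine ((hκ.const_mul 2).const_sub 1).congr' ?_
    filter_upwards [hev] with n ⟨h1, h2⟩
    rw [Nat.cast_sub h2.le]
    have : (n : ℝ) ≠ 0 := by
      have : n ≠ 0 := by omega
      exact_mod_cast this
    push_cast
    field_simp
  have hj1 : Tendsto (fun n : ℕ => n - 2 * k n) atTop atTop := by
    rw [← tendsto_natCast_atTop_iff (R := ℝ)]
    refine (hj.pos_mul_atTop (by linarith)
      (tendsto_natCast_atTop_atTop (R := ℝ))).congr' ?_
    filter_upwards [eventually_gt_atTop 0] with n hn
    have : (n : ℝ) ≠ 0 := by exact_mod_cast hn.ne'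
    field_simp
  have hH : ∀ᶠ y in 𝓝 μ, HasDerivAt matchingEntropy (matchingEntropyDeriv y) y := by
    filter_upwards [Ioo_mem_nhds hμ0 hμ1] with y hy
    exact hasDerivAt_matchingEntropy hy.1 hy.2
  have hexp := (tendsto_mul_sub_of_deriv_eq_zero hH hh hμ hk).rexp
  have hlim := (((((hκ.const_mul 2).inv₀ (by positivity)).mul
    (hκ.sqrt.inv₀ (Real.sqrt_pos.2 hμ0).ne')).mul
    (hj.sqrt.inv₀ (Real.sqrt_pos.2 (by linarith)).ne')).mul
    (tendsto_sqrt_mul_stirlingRatio.comp hk1)).mul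
    (tendsto_sqrt_mul_stirlingRatio.comp hj1) |>.mul hexp
  simp only [← one_div (_ : ℝ)] at hlim
  refine hlim.congr' ?_
  filter_upwards [hev] with n ⟨h1, h2⟩
  rw [hα n (k n) (n - 2 * k n) h1 (by omega), tree_term_eq h1 (by omega), ← Real.exp_nat_mul,
    mul_assoc _ (Real.exp _) (Real.exp _), ← Real.exp_add, ← mul_add, ← sub_eq_add_neg,
    Real.sqrt_div (Nat.cast_nonneg _), Real.sqrt_div (Nat.cast_nonneg _)]
  have hn : (0 : ℝ) < n := by
    have : 0 < n := by omega
    exact_mod_cast this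
  have hkp : (0 : ℝ) < k n := by exact_mod_cast h1
  have hjp : (0 : ℝ) < (n - 2 * k n : ℕ) := by exact_mod_cast (show 0 < n - 2 * k n by omega)
  have s1 := (Real.sqrt_pos.2 hn).ne'
  have s2 := (Real.sqrt_pos.2 hkp).ne'
  have s3 := (Real.sqrt_pos.2 hjp).ne'
  have s4 : √(n : ℝ) ^ 2 = n := Real.sq_sqrt hn.le
  simp only [Function.comp_apply]
  field_simp
  rw [s4]

/-- The number of trees on `n` vertices with a maximal matching having `k` edges, as the
coefficients of an exponential generating function at `ρ * z`. -/
noncomputable def treeCoeff (ρ : ℝ) (n k : ℕ) : ℝ := treeCount (Fin n) k / n.factorial * ρ ^ n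

/-- The number of forests on `n` vertices with a maximal matching having `k` edges, as the
coefficients of an exponential generating function at `ρ * z`. -/
noncomputable def forestCoeff (ρ : ℝ) (n k : ℕ) : ℝ := forestCount (Fin n) k / n.factorial * ρ ^ n

lemma treeCoeff_eq (ρ : ℝ) {n k j : ℕ} (hk : 0 < k) (hn : 2 * k + j = n) :
    treeCoeff ρ n k =
      (2 * k : ℝ) ^ j * (n : ℝ) ^ k / (2 * k * n * k.factorial * j.factorial) * ρ ^ n := by
  have h := treeCount_mul (V := Fin n) hk.ne' (by rw [Fintype.card_fin]; omega)
  rw [Fintype.card_fin, show n - 2 * k = j by omega] at h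
  have h' : (treeCount (Fin n) k : ℝ) * (2 * k * n * k.factorial * j.factorial) =
      n.factorial * (2 * k) ^ j * n ^ k := by exact_mod_cast h
  have hn0 : (n : ℝ) ≠ 0 := by
    have : n ≠ 0 := by omega
    exact_mod_cast this
  have hk0 : (k : ℝ) ≠ 0 := by exact_mod_cast hk.ne'
  rw [treeCoeff]
  congr 1
  rw [div_eq_div_iff (by positivity) (by positivity), h']
  ring

lemma mul_forestCoeff (ρ : ℝ) (n k : ℕ) :
    n * forestCoeff ρ n k = ∑ s ∈ Finset.range (n + 1), s *
      ∑ i ∈ Finset.range (k + 1), treeCoeff ρ s i * forestCoeff ρ (n - s) (k - i) := by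
  have h : (n : ℝ) * forestCount (Fin n) k = ∑ s ∈ Finset.range (n + 1), (n.choose s : ℝ) *
      (s * ∑ i ∈ Finset.range (k + 1),
        (treeCount (Fin s) i : ℝ) * forestCount (Fin (n - s)) (k - i)) := by
    exact_mod_cast mul_forestCount n k
  have h1 : (n : ℝ) * forestCoeff ρ n k =
      n * forestCount (Fin n) k * (ρ ^ n / n.factorial) := by
    rw [forestCoeff]
    ring
  rw [h1, h, Finset.sum_mul]
  refine Finset.sum_congr rfl fun s hs => ?_
  have hs' : s ≤ n := by
    rw [Finset.mem_range] at hs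
    omega
  have hρ : ρ ^ n = ρ ^ s * ρ ^ (n - s) := by rw [← pow_add, Nat.add_sub_cancel' hs']
  rw [Nat.cast_choose ℝ hs', mul_comm, ← mul_assoc, mul_left_comm]
  congr 1
  rw [Finset.mul_sum]
  refine Finset.sum_congr rfl fun i _ => ?_
  rw [treeCoeff, forestCoeff, hρ]
  field_simp

lemma treeCoeff_le {μ : ℝ} (hμ0 : 1 / 4 < μ) (hμ1 : μ < 7 / 16)
    (hμ : matchingEntropyDeriv μ = 0) {n : ℕ} (hn : 1 ≤ n) (k : ℕ) :
    treeCoeff (Real.exp (-matchingEntropy μ)) n k ≤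
      (2 ^ 20 + Real.exp (-matchingEntropy μ) * Real.exp (4 * μ ^ 2)) / (n : ℝ) ^ 3 *
        Real.exp (-4 * ((k - μ * n) ^ 2 / n)) := by
  rcases Nat.eq_zero_or_pos k with rfl | hk
  · rw [treeCoeff, treeCount_zero, Fintype.card_fin]
    split_ifs with h
    · subst h
      have h1 : Real.exp (4 * μ ^ 2) * Real.exp (-4 * (((0 : ℕ) - μ * (1 : ℕ)) ^ 2 / (1 : ℕ))) =
          1 := by
        rw [← Real.exp_add, Real.exp_eq_one_iff]
        push_cast
        ring
      rw [Nat.cast_one, one_pow, div_one, add_mul, mul_assoc (Real.exp _), ← Nat.cast_one (R := ℝ),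
        h1]
      simp only [Nat.factorial_one, Nat.cast_one, div_one, one_mul, pow_one, mul_one]
      exact le_add_of_nonneg_left (by positivity)
    · simp only [Nat.cast_zero, zero_div, zero_mul]
      positivity
  · rcases lt_or_ge n (2 * k) with h | h
    · rw [treeCoeff, treeCount_eq_zero (by rwa [Fintype.card_fin])]
      simp only [Nat.cast_zero, zero_div, zero_mul]
      positivity
    · obtain ⟨j, rfl⟩ := Nat.exists_eq_add_of_le h
      rw [treeCoeff_eq _ hk rfl]
      refine (tree_term_le hμ0 hμ1 hμ hk rfl).trans ?_
      gcongr
      exact le_add_of_nonneg_right (by positivity)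

theorem stmt_18 :
    ∀ x : ℝ,
      Tendsto
        (fun n : ℕ =>
          (Nat.card {p : MMSpace n //
              (p.val.2.ncard : ℝ) ≤ Ebar n + x * Real.sqrt (Vbar n)} : ℝ) / (mN n : ℝ))
        atTop
        (nhds ((Real.sqrt (2 * Real.pi))⁻¹ *
          ∫ t in Set.Iic x, Real.exp (-(t ^ 2) / 2))) := by
  intro x
  obtain ⟨μ, hμ0, hμ1, hμ⟩ := exists_matchingEntropyDeriv_eq_zero
  have hμp : 0 < μ := by linarith
  have hμh : μ < 1 / 2 := by linarith
  set ρ := Real.exp (-matchingEntropy μ) with hρ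
  have hρ0 : 0 < ρ := Real.exp_pos _
  obtain ⟨h, hh, hneg⟩ : ∃ h, HasDerivAt matchingEntropyDeriv h μ ∧ h < 0 :=
    ⟨_, hasDerivAt_matchingEntropyDeriv hμp hμh,
      (deriv_matchingEntropyDeriv_le hμp hμh).trans_lt (by norm_num)⟩
  obtain ⟨v, hv⟩ : ∃ v : NNReal, (v : ℝ) = -1 / h :=
    ⟨⟨-1 / h, (div_pos_of_neg_of_neg (by norm_num) hneg).le⟩, rfl⟩
  have hvpos : 0 < (v : ℝ) := by
    rw [hv]
    exact div_pos_of_neg_of_neg (by norm_num) hneg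
  have hv0 : v ≠ 0 := by
    rintro rfl
    exact hvpos.ne' rfl
  set G := 1 / (2 * μ) * (1 / √μ) * (1 / √(1 - 2 * μ)) * (1 / √(2 * Real.pi)) *
    (1 / √(2 * Real.pi)) * √(2 * Real.pi * v) with hG
  have hGpos : 0 < G := by
    have : 0 < 1 - 2 * μ := by linarith
    positivity
  have hfac : ∀ n : ℕ, 0 < ρ ^ n / n.factorial := fun n => by positivity
  have hsum : ∀ (f : ℕ → ℝ) (n : ℕ), ∑ k ∈ Finset.range (n + 1), f k * forestCoeff ρ n k =
      (∑ k ∈ Finset.range (n + 1), f k * forestCount (Fin n) k) * (ρ ^ n / n.factorial) := by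
    intro f n
    rw [Finset.sum_mul]
    refine Finset.sum_congr rfl fun k _ => ?_
    rw [forestCoeff]
    ring
  have hw : ∀ n : ℕ, mN n * (ρ ^ n / n.factorial) =
      ∑ k ∈ Finset.range (n + 1), forestCoeff ρ n k := by
    intro n
    rw [mN_eq_sum]
    simpa using (hsum (fun _ => 1) n).symm
  have key := tendsto_cdf_of_conv (α := treeCoeff ρ) (β := forestCoeff ρ)
    (C := 2 ^ 20 + ρ * Real.exp (4 * μ ^ 2)) (c := 4) (μ := μ) (G := G) (v := v)
    (w := fun n => mN n * (ρ ^ n / n.factorial)) (E := Ebar) (V := Vbar)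
    (fun n k => by unfold treeCoeff; positivity) (fun n k => by unfold forestCoeff; positivity)
    (by simp [forestCoeff, forestCount_zero])
    (fun n k hnk => by
      rw [treeCoeff, treeCount_eq_zero (by rw [Fintype.card_fin]; omega)]
      simp)
    (fun n k hnk => by
      rw [forestCoeff, forestCount_eq_zero (by omega)]
      simp)
    (by positivity) (by norm_num) hμp hGpos hv0
    (fun n k hn => treeCoeff_le hμ0 hμ1 hμ hn k)
    (fun k y hk => by
      have := tendsto_tree_term hμp hμh hμ hh
        (fun n k j hk hn => treeCoeff_eq ρ hk hn) hk
      convert this using 2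
      have hexp : -(y - 0) ^ 2 / (2 * (v : ℝ)) = h / 2 * y ^ 2 := by
        rw [hv]
        have := hneg.ne
        field_simp
        ring
      rw [ProbabilityTheory.gaussianPDFReal, hexp, hG, ← mul_assoc]
      congr 1
      rw [mul_assoc, mul_inv_cancel₀ (Real.sqrt_pos.2 (by positivity)).ne', mul_one])
    (mul_forestCoeff ρ) hw
    (fun n => by
      rw [hsum (fun k => (k : ℝ)), mul_div_mul_right _ _ (hfac n).ne', Ebar,
        finsum_MMSpace n fun k => (k : ℝ)])
    (fun n => by
      rw [hsum (fun k => (k : ℝ) ^ 2), mul_div_mul_right _ _ (hfac n).ne', Vbar,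
        finsum_MMSpace n fun k => (k : ℝ) ^ 2])
    x
  refine key.congr fun n => ?_
  rw [hsum (fun k => if (k : ℝ) ≤ Ebar n + x * √(Vbar n) then 1 else 0),
    mul_div_mul_right _ _ (hfac n).ne', card_MMSpace_le]
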